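/- arXiv:2202.07748 — 8 statements merged into one kernel-verified Lean document; each statement's English description precedes it below -/
import Mathlib

section
/- There exists exactly one s ∈ (0,1) with s + λ F(s) = 1. (This unique solution is denoted s₋∞.) -/
theorem sInf_exists_unique
    (lam gam kap : ℝ)
    (hlam : lam ∈ Set.Ioo (0:ℝ) 1) (hgam : gam ∈ Set.Ioo (0:ℝ) 1)
    (hkap : kap ∈ Set.Ioc (0:ℝ) 1)
    (f f' F : ℝ → ℝ)
    (hf_maps : ∀ x ∈ Set.Icc (0:ℝ) 1, f x ∈ Set.Icc (0:ℝ) 1)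
    (hf_mono : StrictMonoOn f (Set.Icc (0:ℝ) 1))
    (hf_deriv : ∀ x ∈ Set.Icc (0:ℝ) 1, HasDerivWithinAt f (f' x) (Set.Icc (0:ℝ) 1) x)
    (hf'_cont : ContinuousOn f' (Set.Icc (0:ℝ) 1))
    (hf_zero : f 0 = 0) (hf'_zero : f' 0 = 1 / kap)
    (hf_one : f 1 ∈ Set.Ioc lam 1)
    (hF : ∀ s ∈ Set.Ioc (0:ℝ) 1, F s = ∫ ρ in s..1, 1 / f ρ)
    :
    ∃! s : ℝ, s ∈ Set.Ioo (0:ℝ) 1 ∧ s + lam * F s = 1 := by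
  have hfc : ContinuousOn f (Set.Icc (0:ℝ) 1) := fun x hx => (hf_deriv x hx).continuousWithinAt
  obtain ⟨hl0, hl1⟩ := hlam
  obtain ⟨hfl, hf1⟩ := hf_one
  have h01 : (0:ℝ) ≤ 1 := zero_le_one
  have m0 : (0:ℝ) ∈ Set.Icc (0:ℝ) 1 := ⟨le_refl _, h01⟩
  have m1 : (1:ℝ) ∈ Set.Icc (0:ℝ) 1 := ⟨h01, le_refl _⟩
  -- continuous extension
  obtain ⟨e, hec, hef, hepos⟩ : ∃ e : ℝ → ℝ, Continuous e ∧ (∀ x ∈ Set.Icc (0:ℝ) 1, e x = f x) ∧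
      ∀ x, 0 < x → 0 < e x := by
    refine ⟨Set.IccExtend h01 (Set.restrict (Set.Icc 0 1) f), ?_, ?_, ?_⟩
    · exact hfc.restrict.Icc_extend'
    · intro x hx
      rw [Set.IccExtend_of_mem _ _ hx]; rfl
    · intro x hx
      have h2 := (Set.projIcc (0:ℝ) 1 h01 x).2
      have h3 : (0:ℝ) < Set.projIcc (0:ℝ) 1 h01 x := by
        rw [Set.coe_projIcc]; simp [hx]
      have := hf_mono m0 h2 h3
      rw [hf_zero] at this
      exact this
  have hgc : ContinuousOn (fun x => 1 / e x) (Set.Ioi 0) :=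
    continuousOn_const.div hec.continuousOn (fun x hx => (hepos x hx).ne')
  have hint : ∀ a b : ℝ, 0 < a → 0 < b →
      IntervalIntegrable (fun x => 1 / e x) MeasureTheory.volume a b := by
    intro a b ha hb
    apply ContinuousOn.intervalIntegrable
    apply hgc.mono
    intro x hx
    exact lt_of_lt_of_le (lt_min ha hb) hx.1
  set G : ℝ → ℝ := fun s => s + lam * ∫ ρ in s..1, 1 / e ρ with hG
  have hGF : ∀ s ∈ Set.Ioc (0:ℝ) 1, s + lam * F s = G s := by
    intro s hs
    rw [hF s hs, hG]
    simp only
    congr 2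
    apply intervalIntegral.integral_congr
    intro x hx
    rw [Set.uIcc_of_le hs.2] at hx
    simp only
    rw [hef x ⟨hs.1.le.trans hx.1, hx.2⟩]
  have hGd : ∀ s, 0 < s → HasDerivAt G (1 + lam * (-(1 / e s))) s := by
    intro s hs
    refine (hasDerivAt_id s).add (HasDerivAt.const_mul lam ?_)
    refine intervalIntegral.integral_hasDerivAt_left (hint s 1 hs one_pos) ?_ ?_
    · exact hgc.stronglyMeasurableAtFilter isOpen_Ioi s hs
    · exact hgc.continuousAt (Ioi_mem_nhds hs)
  have hG1 : G 1 = 1 := by simp [hG]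
  obtain ⟨a, ha, hfa⟩ : lam ∈ f '' Set.Ioo 0 1 := by
    apply intermediate_value_Ioo h01 hfc
    rw [hf_zero]; exact ⟨hl0, hfl⟩
  have haI : a ∈ Set.Icc (0:ℝ) 1 := ⟨ha.1.le, ha.2.le⟩
  have hmono : StrictMonoOn G (Set.Icc a 1) := by
    apply strictMonoOn_of_deriv_pos (convex_Icc a 1)
    · exact fun x hx => (hGd x (ha.1.trans_le hx.1)).continuousAt.continuousWithinAt
    · intro x hx
      rw [interior_Icc] at hx
      have hx0 := ha.1.trans hx.1
      rw [(hGd x hx0).deriv]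
      have hxI : x ∈ Set.Icc (0:ℝ) 1 := ⟨hx0.le, hx.2.le⟩
      have h1 := hf_mono haI hxI hx.1
      have h2 := hepos x hx0
      rw [hfa, ← hef x hxI] at h1
      have : lam / e x < 1 := (div_lt_one h2).2 h1
      have h4 : lam * (-(1 / e x)) = - (lam / e x) := by ring
      linarith
  have hanti : StrictAntiOn G (Set.Ioc 0 a) := by
    apply strictAntiOn_of_deriv_neg (convex_Ioc 0 a)
    · exact fun x hx => (hGd x hx.1).continuousAt.continuousWithinAt
    · intro x hx
      rw [interior_Ioc] at hx
      have hx0 := hx.1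
      rw [(hGd x hx0).deriv]
      have hxI : x ∈ Set.Icc (0:ℝ) 1 := ⟨hx0.le, hx.2.le.trans ha.2.le⟩
      have h1 := hf_mono hxI haI hx.2
      have h2 := hepos x hx0
      rw [hfa, ← hef x hxI] at h1
      have : 1 < lam / e x := (one_lt_div h2).2 h1
      have h4 : lam * (-(1 / e x)) = - (lam / e x) := by ring
      linarith
  have hlt : ∀ s ∈ Set.Ico a 1, G s < 1 := by
    intro s hs
    rw [← hG1]
    exact hmono ⟨hs.1, hs.2.le⟩ ⟨ha.2.le, le_refl _⟩ hs.2
  -- a point where G is large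
  obtain ⟨b, hb0, hb1, hGb⟩ : ∃ b, 0 < b ∧ b < 1 ∧ 1 < G b := by
    obtain ⟨C, hC⟩ := isCompact_Icc.exists_bound_of_continuousOn hf'_cont
    have hbd : ∀ x ∈ Set.Icc (0:ℝ) 1, f x ≤ C * x := by
      intro x hx
      have := (convex_Icc (0:ℝ) 1).norm_image_sub_le_of_norm_hasDerivWithin_le hf_deriv hC m0 hx
      rw [hf_zero, sub_zero, sub_zero, Real.norm_eq_abs, Real.norm_eq_abs,
        abs_of_nonneg hx.1] at this
      exact (le_abs_self _).trans this
    have hCpos : 0 < C := by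
      have := hbd 1 m1
      linarith
    have hb0 : 0 < Real.exp (-(C / lam)) := Real.exp_pos _
    have hb1 : Real.exp (-(C / lam)) < 1 := by
      rw [Real.exp_lt_one_iff]
      have : 0 < C / lam := by positivity
      linarith
    refine ⟨Real.exp (-(C / lam)), hb0, hb1, ?_⟩
    set b := Real.exp (-(C / lam)) with hb
    have h5 : ∫ ρ in b..1, C⁻¹ * (1 / ρ) = C⁻¹ * (C / lam) := by
      rw [intervalIntegral.integral_const_mul, integral_one_div_of_pos hb0 one_pos,
        Real.log_div one_ne_zero hb0.ne', hb, Real.log_exp, Real.log_one]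
      ring
    have h6 : ∫ ρ in b..1, C⁻¹ * (1 / ρ) ≤ ∫ ρ in b..1, 1 / e ρ := by
      apply intervalIntegral.integral_mono_on hb1.le _ (hint b 1 hb0 one_pos)
      · intro x hx
        have hx0 := hb0.trans_le hx.1
        have hxI : x ∈ Set.Icc (0:ℝ) 1 := ⟨hx0.le, hx.2⟩
        have h7 := hbd x hxI
        rw [← hef x hxI] at h7
        calc C⁻¹ * (1 / x) = 1 / (C * x) := by field_simp
          _ ≤ 1 / e x := one_div_le_one_div_of_le (hepos x hx0) h7
      · apply ContinuousOn.intervalIntegrable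
        rw [Set.uIcc_of_le hb1.le]
        exact continuousOn_const.mul (continuousOn_const.div continuousOn_id
          (fun x hx => (hb0.trans_le hx.1).ne'))
    rw [h5] at h6
    have h8 : lam * (C⁻¹ * (C / lam)) = 1 := by field_simp
    have h9 := mul_le_mul_of_nonneg_left h6 hl0.le
    simp only [hG]
    linarith
  have hba : b < a := by
    by_contra h
    exact absurd (hlt b ⟨not_lt.1 h, hb1⟩) (not_lt.2 hGb.le)
  obtain ⟨s, hs, hGs⟩ : (1:ℝ) ∈ G '' Set.Ioo b a := by
    apply intermediate_value_Ioo' hba.le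
    · exact fun x hx => (hGd x (hb0.trans_le hx.1)).continuousAt.continuousWithinAt
    · exact ⟨hlt a ⟨le_refl _, ha.2⟩, hGb⟩
  have hs0 := hb0.trans hs.1
  have hs1 := hs.2.trans ha.2
  refine ⟨s, ⟨⟨hs0, hs1⟩, by rw [hGF s ⟨hs0, hs1.le⟩, hGs]⟩, ?_⟩
  rintro t ⟨ht, hGt⟩
  rw [hGF t ⟨ht.1, ht.2.le⟩] at hGt
  have hta : t < a := by
    by_contra h
    exact absurd (hlt t ⟨not_lt.1 h, ht.2⟩) (not_lt.2 hGt.ge)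
  exact hanti.injOn ⟨ht.1, hta.le⟩ ⟨hs0, hs.2.le⟩ (hGt.trans hGs.symm)
end

section
/- 𝒢(s) → +∞ as s → 0⁺. -/
theorem G_tendsto_atTop
    (lam gam kap : ℝ)
    (hlam : lam ∈ Set.Ioo (0:ℝ) 1) (hgam : gam ∈ Set.Ioo (0:ℝ) 1)
    (hkap : kap ∈ Set.Ioc (0:ℝ) 1)
    (f f' F : ℝ → ℝ)
    (hf_maps : ∀ x ∈ Set.Icc (0:ℝ) 1, f x ∈ Set.Icc (0:ℝ) 1)
    (hf_mono : StrictMonoOn f (Set.Icc (0:ℝ) 1))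
    (hf_deriv : ∀ x ∈ Set.Icc (0:ℝ) 1, HasDerivWithinAt f (f' x) (Set.Icc (0:ℝ) 1) x)
    (hf'_cont : ContinuousOn f' (Set.Icc (0:ℝ) 1))
    (hf_zero : f 0 = 0) (hf'_zero : f' 0 = 1 / kap)
    (hf_one : f 1 ∈ Set.Ioc lam 1)
    (hF : ∀ s ∈ Set.Ioc (0:ℝ) 1, F s = ∫ ρ in s..1, 1 / f ρ)
    (G : ℝ → ℝ)
    (hG : ∀ s ∈ Set.Ioc (0:ℝ) 1, G s = ∫ ρ in s..1, (ρ + lam * F ρ - (1 - gam)) / f ρ)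
    :
    Filter.Tendsto G (nhdsWithin 0 (Set.Ioi 0)) Filter.atTop := by
  have hfc : ContinuousOn f (Set.Icc 0 1) := fun x hx => (hf_deriv x hx).continuousWithinAt
  have hpos : ∀ x ∈ Set.Ioc (0:ℝ) 1, 0 < f x := by
    intro x hx
    have := hf_mono (Set.left_mem_Icc.2 zero_le_one) ⟨hx.1.le, hx.2⟩ hx.1
    rwa [hf_zero] at this
  have hinvc : ContinuousOn (fun x => 1 / f x) (Set.Ioc 0 1) :=
    continuousOn_const.div (hfc.mono Set.Ioc_subset_Icc_self) (fun x hx => (hpos x hx).ne')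
  have hsub : ∀ s : ℝ, 0 < s → Set.Icc s 1 ⊆ Set.Ioc 0 1 := fun s hs x hx => ⟨hs.trans_le hx.1, hx.2⟩
  have hint : ∀ s ∈ Set.Ioc (0:ℝ) 1, IntervalIntegrable (fun x => 1 / f x) MeasureTheory.volume s 1 := by
    intro s hs
    apply ContinuousOn.intervalIntegrable
    rw [Set.uIcc_of_le hs.2]
    exact hinvc.mono (hsub s hs.1)
  have hFd : ∀ x ∈ Set.Ioo (0:ℝ) 1, HasDerivAt F (-(1 / f x)) x := by
    intro x hx
    have hc : ContinuousOn (fun x => 1 / f x) (Set.Ioo 0 1) := hinvc.mono Set.Ioo_subset_Ioc_self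
    have h1 := intervalIntegral.integral_hasDerivAt_left (hint x ⟨hx.1, hx.2.le⟩)
      (hc.stronglyMeasurableAtFilter isOpen_Ioo x hx) (hc.continuousAt (isOpen_Ioo.mem_nhds hx))
    refine h1.congr_of_eventuallyEq ?_
    filter_upwards [isOpen_Ioo.mem_nhds hx] with y hy
    exact hF y ⟨hy.1, hy.2.le⟩
  have hFc : ∀ s ∈ Set.Ioc (0:ℝ) 1, ContinuousOn F (Set.Icc s 1) := by
    intro s hs
    have h1 : ContinuousOn (fun x => ∫ ρ in x..1, 1 / f ρ) (Set.uIcc s 1) := by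
      apply intervalIntegral.continuousOn_primitive_interval_left
      rw [Set.uIcc_of_le hs.2]
      exact (hinvc.mono (hsub s hs.1)).integrableOn_Icc
    rw [Set.uIcc_of_le hs.2] at h1
    exact h1.congr (fun x hx => hF x (hsub s hs.1 hx))
  have hF1 : F 1 = 0 := by rw [hF 1 ⟨one_pos, le_rfl⟩]; simp
  obtain ⟨C, hC⟩ := isCompact_Icc.exists_bound_of_continuousOn hf'_cont
  have hfC : ∀ x ∈ Set.Icc (0:ℝ) 1, f x ≤ C * x := by
    intro x hx
    have h := (convex_Icc (0:ℝ) 1).norm_image_sub_le_of_norm_hasDerivWithin_le hf_deriv hC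
      (Set.left_mem_Icc.2 zero_le_one) hx
    rw [hf_zero, sub_zero, sub_zero, Real.norm_eq_abs, Real.norm_eq_abs, abs_of_nonneg hx.1] at h
    exact (le_abs_self _).trans h
  have hCpos : 0 < C := by
    have h1 := hfC 1 ⟨zero_le_one, le_rfl⟩
    have h2 := hpos 1 ⟨one_pos, le_rfl⟩
    linarith
  have hFlow : ∀ s ∈ Set.Ioc (0:ℝ) 1, C⁻¹ * (-Real.log s) ≤ F s := by
    intro s hs
    have h0 : (0:ℝ) ∉ Set.uIcc s 1 := by
      rw [Set.uIcc_of_le hs.2]; exact fun h => absurd h.1 (not_le.2 hs.1)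
    have h1 : ∫ x in s..1, C⁻¹ * x⁻¹ = C⁻¹ * (-Real.log s) := by
      rw [intervalIntegral.integral_const_mul, integral_inv h0, one_div, Real.log_inv]
    rw [hF s hs, ← h1]
    apply intervalIntegral.integral_mono_on hs.2 _ (hint s hs)
    · intro x hx
      have hx' := hsub s hs.1 hx
      rw [← mul_inv, one_div]
      exact inv_anti₀ (hpos x hx') (hfC x ⟨hx'.1.le, hx'.2⟩)
    · apply ContinuousOn.intervalIntegrable
      refine continuousOn_const.mul (continuousOn_id.inv₀ ?_)
      rintro x hx rfl
      exact h0 hx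
  have hFtop : Filter.Tendsto F (nhdsWithin 0 (Set.Ioi 0)) Filter.atTop := by
    have h1 : Filter.Tendsto (fun s => C⁻¹ * (-Real.log s)) (nhdsWithin 0 (Set.Ioi 0)) Filter.atTop :=
      (Filter.tendsto_neg_atBot_atTop.comp Real.tendsto_log_nhdsGT_zero).const_mul_atTop
        (inv_pos.2 hCpos)
    refine Filter.tendsto_atTop_mono' _ ?_ h1
    filter_upwards [Ioc_mem_nhdsGT (zero_lt_one' ℝ)] with s hs
    exact hFlow s hs
  have hGlow : ∀ s ∈ Set.Ioc (0:ℝ) 1, F s * (lam / 2 * F s - (1 - gam)) ≤ G s := by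
    intro s hs
    have hsc := hsub s hs.1
    have hfcs : ContinuousOn f (Set.Icc s 1) := hfc.mono (hsc.trans Set.Ioc_subset_Icc_self)
    have hne : ∀ x ∈ Set.Icc s 1, f x ≠ 0 := fun x hx => (hpos x (hsc hx)).ne'
    have hi1 : IntervalIntegrable (fun x => (lam * F x - (1 - gam)) / f x) MeasureTheory.volume s 1 := by
      apply ContinuousOn.intervalIntegrable
      rw [Set.uIcc_of_le hs.2]
      exact (((hFc s hs).const_smul lam).sub continuousOn_const).div hfcs hne
    have hi2 : IntervalIntegrable (fun x => (x + lam * F x - (1 - gam)) / f x) MeasureTheory.volume s 1 := by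
      apply ContinuousOn.intervalIntegrable
      rw [Set.uIcc_of_le hs.2]
      exact ((continuousOn_id.add ((hFc s hs).const_smul lam)).sub continuousOn_const).div hfcs hne
    have h1 : ∫ x in s..1, (lam * F x - (1 - gam)) / f x = F s * (lam / 2 * F s - (1 - gam)) := by
      have := intervalIntegral.integral_eq_sub_of_hasDerivAt_of_le (f := fun x => -(F x * (lam / 2 * F x - (1 - gam))))
        hs.2 ((hFc s hs).mul (((hFc s hs).const_smul (lam/2)).sub continuousOn_const)).neg
        (f' := fun x => (lam * F x - (1 - gam)) / f x) ?_ hi1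
      · rw [this, hF1]; ring
      · intro x hx
        have hd := hFd x ⟨hs.1.trans hx.1, hx.2⟩
        convert (hd.mul ((hd.const_mul (lam/2)).sub_const (1 - gam))).neg using 1
        · rfl
        · ring
    rw [hG s hs, ← h1]
    apply intervalIntegral.integral_mono_on hs.2 hi1 hi2
    intro x hx
    have hx' := hsc hx
    apply div_le_div_of_nonneg_right _ (hpos x hx').le
    linarith [hx'.1]
  have hT : Filter.Tendsto (fun s => F s * (lam / 2 * F s - (1 - gam))) (nhdsWithin 0 (Set.Ioi 0)) Filter.atTop := by
    apply hFtop.atTop_mul_atTop₀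
    exact Filter.tendsto_atTop_add_const_right _ _ (hFtop.const_mul_atTop (half_pos hlam.1))
  refine Filter.tendsto_atTop_mono' _ ?_ hT
  filter_upwards [Ioc_mem_nhdsGT (zero_lt_one' ℝ)] with s hs
  exact hGlow s hs
end

section
/- Under the stated parameter condition, ℓ(f⁻¹(λ)) > 1 and the equation ℓ(s) = 1 has exactly two solutions in (0,1); denoting them s_* < s^*, one has s_* < f⁻¹(λ) < s^*. -/
theorem nullcline_two_intersections
    (lam gam kap : ℝ)
    (hlam : lam ∈ Set.Ioo (0:ℝ) 1) (hgam : gam ∈ Set.Ioo (0:ℝ) 1)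
    (hkap : kap ∈ Set.Ioc (0:ℝ) 1)
    (f f' F : ℝ → ℝ)
    (hf_maps : ∀ x ∈ Set.Icc (0:ℝ) 1, f x ∈ Set.Icc (0:ℝ) 1)
    (hf_mono : StrictMonoOn f (Set.Icc (0:ℝ) 1))
    (hf_deriv : ∀ x ∈ Set.Icc (0:ℝ) 1, HasDerivWithinAt f (f' x) (Set.Icc (0:ℝ) 1) x)
    (hf'_cont : ContinuousOn f' (Set.Icc (0:ℝ) 1))
    (hf_zero : f 0 = 0) (hf'_zero : f' 0 = 1 / kap)
    (hf_one : f 1 ∈ Set.Ioc lam 1)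
    (hF : ∀ s ∈ Set.Ioc (0:ℝ) 1, F s = ∫ ρ in s..1, 1 / f ρ)
    (ell : ℝ → ℝ)
    (hell : ∀ s ∈ Set.Ioc (0:ℝ) 1, ell s = 1 / gam * ((1 - s) - lam * F s))
    (sM : ℝ) (hsM_mem : sM ∈ Set.Ioo (0:ℝ) 1) (hsM_eq : f sM = lam)
    (hpar : sM + lam * F sM < 1 - gam)
    :
    1 < ell sM ∧
    ∃ sl su : ℝ, sl ∈ Set.Ioo (0:ℝ) 1 ∧ su ∈ Set.Ioo (0:ℝ) 1 ∧
      sl < sM ∧ sM < su ∧ ell sl = 1 ∧ ell su = 1 ∧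
      ∀ s ∈ Set.Ioo (0:ℝ) 1, ell s = 1 → s = sl ∨ s = su := by
  obtain ⟨hl0, hl1⟩ := hlam
  obtain ⟨hg0, hg1⟩ := hgam
  obtain ⟨hM0, hM1⟩ := hsM_mem
  have hfc : ContinuousOn f (Set.Icc 0 1) := fun x hx => (hf_deriv x hx).continuousWithinAt
  have hfpos : ∀ x, 0 < x → x ≤ 1 → 0 < f x := by
    intro x h0 h1
    have := hf_mono (Set.left_mem_Icc.2 zero_le_one) ⟨h0.le, h1⟩ h0
    rwa [hf_zero] at this
  have hcont : ∀ a, 0 < a → ContinuousOn (fun ρ => 1 / f ρ) (Set.Icc a 1) := by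
    intro a ha
    refine continuousOn_const.div (hfc.mono (Set.Icc_subset_Icc_left ha.le)) ?_
    intro x hx
    exact (hfpos x (ha.trans_le hx.1) hx.2).ne'
  have hint : ∀ a b, 0 < a → a ≤ b → b ≤ 1 →
      IntervalIntegrable (fun ρ => 1 / f ρ) MeasureTheory.volume a b := by
    intro a b ha hab hb
    apply ContinuousOn.intervalIntegrable
    rw [Set.uIcc_of_le hab]
    exact (hcont a ha).mono (Set.Icc_subset_Icc_right hb)
  have hdiff : ∀ s t, 0 < s → s ≤ t → t ≤ 1 → F s - F t = ∫ ρ in s..t, 1 / f ρ := by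
    intro s t hs hst ht
    rw [hF s ⟨hs, hst.trans ht⟩, hF t ⟨hs.trans_le hst, ht⟩,
      ← intervalIntegral.integral_add_adjacent_intervals (hint s t hs hst ht)
        (hint t 1 (hs.trans_le hst) ht le_rfl)]
    ring
  have hlow : ∀ s t, 0 < s → s ≤ t → t ≤ 1 → (t - s) * (1 / f t) ≤ F s - F t := by
    intro s t hs hst ht
    rw [hdiff s t hs hst ht]
    have := intervalIntegral.integral_mono_on hst
      (intervalIntegrable_const (c := 1 / f t)) (hint s t hs hst ht) (fun x hx =>
        one_div_le_one_div_of_le (hfpos x (hs.trans_le hx.1) (hx.2.trans ht))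
          (hf_mono.monotoneOn ⟨(hs.trans_le hx.1).le, hx.2.trans ht⟩
            ⟨(hs.trans_le hst).le, ht⟩ hx.2))
    simpa using this
  have hupp : ∀ s t, 0 < s → s ≤ t → t ≤ 1 → F s - F t ≤ (t - s) * (1 / f s) := by
    intro s t hs hst ht
    rw [hdiff s t hs hst ht]
    have := intervalIntegral.integral_mono_on hst (hint s t hs hst ht)
      (intervalIntegrable_const (c := 1 / f s)) (fun x hx =>
        one_div_le_one_div_of_le (hfpos s hs (hst.trans ht))
          (hf_mono.monotoneOn ⟨hs.le, hst.trans ht⟩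
            ⟨(hs.trans_le hx.1).le, hx.2.trans ht⟩ hx.1))
    simpa using this
  have hiff : ∀ s, 0 < s → s ≤ 1 → (ell s = 1 ↔ (1 - s) - lam * F s = gam) := by
    intro s h0 h1
    rw [hell s ⟨h0, h1⟩]
    constructor
    · intro h
      field_simp at h
      linarith
    · intro h
      rw [h]
      field_simp
  have hGM : gam < (1 - sM) - lam * F sM := by linarith
  have hellM : 1 < ell sM := by
    rw [hell sM ⟨hM0, hM1.le⟩, one_div, inv_mul_eq_div, one_lt_div hg0]
    exact hGM
  have hincr : ∀ s t, 0 < s → s < t → t < sM →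
      (1 - s) - lam * F s < (1 - t) - lam * F t := by
    intro s t hs hst ht
    have h1 := hlow s t hs hst.le (ht.trans hM1).le
    have hp := hfpos t (hs.trans hst) (ht.trans hM1).le
    have h2 : f t < lam := by
      rw [← hsM_eq]
      exact hf_mono ⟨(hs.trans hst).le, (ht.trans hM1).le⟩ ⟨hM0.le, hM1.le⟩ ht
    have h3 : 1 < lam * (1 / f t) := by
      rw [mul_one_div, one_lt_div hp]
      exact h2
    have h4 := mul_le_mul_of_nonneg_left h1 hl0.le
    have h5 := mul_lt_mul_of_pos_left h3 (sub_pos.2 hst)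
    nlinarith
  have hdecr : ∀ s t, sM < s → s < t → t ≤ 1 →
      (1 - t) - lam * F t < (1 - s) - lam * F s := by
    intro s t hs hst ht
    have hs0 := hM0.trans hs
    have h1 := hupp s t hs0 hst.le ht
    have hp := hfpos s hs0 (hst.le.trans ht)
    have h2 : lam < f s := by
      rw [← hsM_eq]
      exact hf_mono ⟨hM0.le, hM1.le⟩ ⟨hs0.le, hst.le.trans ht⟩ hs
    have h3 : lam * (1 / f s) < 1 := by
      rw [mul_one_div, div_lt_one hp]
      exact h2
    have h4 := mul_le_mul_of_nonneg_left h1 hl0.le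
    have h5 := mul_lt_mul_of_pos_left h3 (sub_pos.2 hst)
    nlinarith
  have hGc : ∀ a, 0 < a → a ≤ 1 → ContinuousOn (fun s => (1 - s) - lam * F s) (Set.Icc a 1) := by
    intro a ha ha1
    have hFc : ContinuousOn F (Set.Icc a 1) := by
      have h := intervalIntegral.continuousOn_primitive_interval_left
        (f := fun ρ => 1 / f ρ) (μ := MeasureTheory.volume) (a := a) (b := 1) (by
          rw [Set.uIcc_of_le ha1]
          exact (hcont a ha).integrableOn_Icc)
      rw [Set.uIcc_of_le ha1] at h
      exact h.congr (fun x hx => hF x ⟨ha.trans_le hx.1, hx.2⟩)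
    fun_prop
  have hF1 : F 1 = 0 := by
    rw [hF 1 ⟨one_pos, le_rfl⟩]
    simp
  -- linear upper bound on f
  obtain ⟨C, hC0, hC⟩ : ∃ C, 0 < C ∧ ∀ x ∈ Set.Icc (0:ℝ) 1, f x ≤ C * x := by
    obtain ⟨C, hC⟩ := isCompact_Icc.exists_bound_of_continuousOn hf'_cont
    refine ⟨max C 1, by positivity, fun x hx => ?_⟩
    have h := (convex_Icc (0:ℝ) 1).norm_image_sub_le_of_norm_hasDerivWithin_le
      hf_deriv hC (Set.left_mem_Icc.2 zero_le_one) hx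
    rw [hf_zero, sub_zero, sub_zero, Real.norm_eq_abs, Real.norm_eq_abs, abs_of_nonneg hx.1] at h
    exact (le_abs_self _).trans (h.trans (mul_le_mul_of_nonneg_right (le_max_left _ _) hx.1))
  obtain ⟨a, ha0, haM, haG⟩ : ∃ a, 0 < a ∧ a ≤ sM ∧ (1 - a) - lam * F a < gam := by
    have ha0 : 0 < min sM (Real.exp (-(C / lam))) := lt_min hM0 (Real.exp_pos _)
    refine ⟨min sM (Real.exp (-(C / lam))), ha0, min_le_left _ _, ?_⟩
    have haM : min sM (Real.exp (-(C / lam))) ≤ sM := min_le_left _ _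
    have haE := min_le_right sM (Real.exp (-(C / lam)))
    generalize min sM (Real.exp (-(C / lam))) = a at *
    have ha1 : a ≤ 1 := haM.trans hM1.le
    have hlog : Real.log a ≤ -(C / lam) := by
      rw [Real.log_le_iff_le_exp ha0]
      exact haE
    have hi : IntervalIntegrable (fun ρ : ℝ => C⁻¹ * (1 / ρ)) MeasureTheory.volume a 1 := by
      apply ContinuousOn.intervalIntegrable
      rw [Set.uIcc_of_le ha1]
      refine continuousOn_const.mul (continuousOn_const.div continuousOn_id ?_)
      intro x hx
      exact (ha0.trans_le hx.1).ne'
    have h := intervalIntegral.integral_mono_on ha1 hi (hint a 1 ha0 ha1 le_rfl) (fun x hx => by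
      have hx0 := ha0.trans_le hx.1
      have := one_div_le_one_div_of_le (hfpos x hx0 hx.2) (hC x ⟨hx0.le, hx.2⟩)
      calc C⁻¹ * (1 / x) = 1 / (C * x) := by field_simp
        _ ≤ _ := this)
    rw [intervalIntegral.integral_const_mul, integral_one_div_of_pos ha0 one_pos,
      ← hF a ⟨ha0, ha1⟩, one_div, Real.log_inv] at h
    have h2 : lam⁻¹ ≤ F a := by
      refine le_trans ?_ h
      calc lam⁻¹ = C⁻¹ * (C / lam) := by field_simp
        _ ≤ _ := mul_le_mul_of_nonneg_left (by linarith) (by positivity)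
    have h3 : 1 ≤ lam * F a := by
      calc 1 = lam * lam⁻¹ := by field_simp
        _ ≤ _ := mul_le_mul_of_nonneg_left h2 hl0.le
    linarith
  obtain ⟨sl, hsl, hslG⟩ := intermediate_value_Icc haM
    ((hGc a ha0 (haM.trans hM1.le)).mono (Set.Icc_subset_Icc_right hM1.le)) ⟨haG.le, hGM.le⟩
  obtain ⟨su, hsu, hsuG⟩ := intermediate_value_Icc' hM1.le
    (hGc sM hM0 hM1.le) (show gam ∈ Set.Icc _ _ from ⟨by simp [hF1, hg0.le], hGM.le⟩)
  simp only at hslG hsuG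
  have hsl0 : 0 < sl := ha0.trans_le hsl.1
  have hslM : sl < sM := lt_of_le_of_ne hsl.2 (by
    rintro rfl
    linarith)
  have hsuM : sM < su := lt_of_le_of_ne hsu.1 (by
    rintro rfl
    linarith)
  have hsu1 : su < 1 := lt_of_le_of_ne hsu.2 (by
    rintro rfl
    rw [hF1] at hsuG
    linarith)
  refine ⟨hellM, sl, su, ⟨hsl0, hslM.trans hM1⟩, ⟨hM0.trans hsuM, hsu1⟩, hslM, hsuM,
    (hiff sl hsl0 (hslM.trans hM1).le).2 hslG, (hiff su (hM0.trans hsuM) hsu1.le).2 hsuG, ?_⟩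
  intro s hs h
  have hG := (hiff s hs.1 hs.2.le).1 h
  rcases lt_trichotomy s sM with hlt | rfl | hgt
  · left
    rcases lt_trichotomy s sl with h1 | h1 | h1
    · have := hincr s sl hs.1 h1 hslM
      linarith
    · exact h1
    · have := hincr sl s hsl0 h1 hlt
      linarith
  · linarith
  · right
    rcases lt_trichotomy s su with h1 | h1 | h1
    · have := hdecr s su hgt h1 hsu1.le
      linarith
    · exact h1
    · have := hdecr su s hsuM h1 hs.2.le
      linarith
end

section
/- Let v > 0. There exist no τ₁ ∈ (0,∞) and differentiable pair (M,S) : [0,τ₁) → [0,1) × [s₋∞,1] satisfying dM/dτ = v(ℓ(S) − M) and dS/dτ = (γ/v) f(S) M D(M) on [0,τ₁) with lim_{τ→τ₁⁻} M(τ) = 1; that is, no orbit of the system starting in [0,1) × [s₋∞,1] can exit this region through the boundary {m = 1}. -/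
theorem no_exit_through_m_eq_one
    (lam gam kap : ℝ)
    (hlam : lam ∈ Set.Ioo (0:ℝ) 1) (hgam : gam ∈ Set.Ioo (0:ℝ) 1)
    (hkap : kap ∈ Set.Ioc (0:ℝ) 1)
    (f f' F : ℝ → ℝ)
    (hf_maps : ∀ x ∈ Set.Icc (0:ℝ) 1, f x ∈ Set.Icc (0:ℝ) 1)
    (hf_mono : StrictMonoOn f (Set.Icc (0:ℝ) 1))
    (hf_deriv : ∀ x ∈ Set.Icc (0:ℝ) 1, HasDerivWithinAt f (f' x) (Set.Icc (0:ℝ) 1) x)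
    (hf'_cont : ContinuousOn f' (Set.Icc (0:ℝ) 1))
    (hf_zero : f 0 = 0) (hf'_zero : f' 0 = 1 / kap)
    (hf_one : f 1 ∈ Set.Ioc lam 1)
    (hF : ∀ s ∈ Set.Ioc (0:ℝ) 1, F s = ∫ ρ in s..1, 1 / f ρ)
    (D : ℝ → ℝ) (a b : ℝ) (ha : 1 < a) (hb : 1 < b)
    (hD_mono : MonotoneOn D (Set.Ico (0:ℝ) 1))
    (hD_nonneg : ∀ m ∈ Set.Ico (0:ℝ) 1, 0 ≤ D m)
    (hD_smooth : ∃ D' : ℝ → ℝ, ContinuousOn D' (Set.Ico (0:ℝ) 1) ∧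
      ∀ m ∈ Set.Ico (0:ℝ) 1, HasDerivWithinAt D (D' m) (Set.Ico (0:ℝ) 1) m)
    (LD0 LD1 : ℝ) (hLD0 : 0 < LD0) (hLD1 : 0 < LD1)
    (hD_zero : Filter.Tendsto (fun m => D m / m ^ a) (nhdsWithin 0 (Set.Ioi 0)) (nhds LD0))
    (hD_one : Filter.Tendsto (fun m => (1 - m) ^ b * D m) (nhdsWithin 1 (Set.Iio 1)) (nhds LD1))
    (ell : ℝ → ℝ)
    (hell : ∀ s ∈ Set.Ioc (0:ℝ) 1, ell s = 1 / gam * ((1 - s) - lam * F s))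
    (sInf : ℝ) (hsInf_mem : sInf ∈ Set.Ioo (0:ℝ) 1)
    (hsInf_eq : sInf + lam * F sInf = 1)
    (hsInf_uniq : ∀ s ∈ Set.Ioo (0:ℝ) 1, s + lam * F s = 1 → s = sInf)
    (sM : ℝ) (hsM_mem : sM ∈ Set.Ioo (0:ℝ) 1) (hsM_eq : f sM = lam)
    (hpar : sM + lam * F sM < 1 - gam)
    (v : ℝ) (hv : 0 < v) :
    ¬ ∃ (τ₁ : ℝ) (M S : ℝ → ℝ), 0 < τ₁ ∧
      (∀ τ ∈ Set.Ico (0:ℝ) τ₁, M τ ∈ Set.Ico (0:ℝ) 1 ∧ S τ ∈ Set.Icc sInf 1) ∧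
      (∀ τ ∈ Set.Ico (0:ℝ) τ₁,
        HasDerivWithinAt M (v * (ell (S τ) - M τ)) (Set.Ico (0:ℝ) τ₁) τ ∧
        HasDerivWithinAt S (gam / v * (f (S τ) * (M τ * D (M τ)))) (Set.Ico (0:ℝ) τ₁) τ) ∧
      Filter.Tendsto M (nhdsWithin τ₁ (Set.Iio τ₁)) (nhds 1) := by
  rintro ⟨τ₁, M, S, hτ, hmem, hode, hlim⟩
  obtain ⟨hs0, hs1⟩ := hsInf_mem
  obtain ⟨hg0, hg1⟩ := hgam
  obtain ⟨hl0, hl1⟩ := hlam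
  have hfpos : 0 < f sInf := by
    have := hf_mono (Set.left_mem_Icc.2 zero_le_one) ⟨hs0.le, hs1.le⟩ hs0
    rwa [hf_zero] at this
  have hfge : ∀ s ∈ Set.Icc sInf 1, f sInf ≤ f s := fun s hs =>
    hf_mono.monotoneOn ⟨hs0.le, hs1.le⟩ ⟨hs0.le.trans hs.1, hs.2⟩ hs.1
  have hFb : ∀ s ∈ Set.Icc sInf 1, |F s| ≤ 1 / f sInf := by
    intro s hs
    rw [hF s ⟨hs0.trans_le hs.1, hs.2⟩]
    have h1 : ‖∫ ρ in s..1, 1 / f ρ‖ ≤ 1 / f sInf * |1 - s| := by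
      apply intervalIntegral.norm_integral_le_of_norm_le_const
      intro x hx
      rw [Set.uIoc_of_le hs.2] at hx
      have h2 := hfge x ⟨hs.1.trans hx.1.le, hx.2⟩
      have h3 : 0 < f x := hfpos.trans_le h2
      rw [Real.norm_of_nonneg (by positivity)]
      exact one_div_le_one_div_of_le hfpos h2
    rw [Real.norm_eq_abs] at h1
    refine h1.trans ?_
    have h4 : |1 - s| ≤ 1 := by
      rw [abs_le]; constructor <;> linarith [hs.1, hs.2]
    have h5 : 0 ≤ 1 / f sInf := by positivity
    nlinarith
  obtain ⟨K, hK0, hK⟩ : ∃ K : ℝ, 0 < K ∧ ∀ τ ∈ Set.Ico (0:ℝ) τ₁,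
      ‖v * (ell (S τ) - M τ)‖ ≤ K := by
    refine ⟨v * (1 / gam * (1 + 1 / f sInf) + 1), by positivity, ?_⟩
    intro τ ht
    obtain ⟨hM, hS⟩ := hmem τ ht
    rw [norm_mul, Real.norm_of_nonneg hv.le, Real.norm_eq_abs]
    apply mul_le_mul_of_nonneg_left _ hv.le
    have h1 : |ell (S τ)| ≤ 1 / gam * (1 + 1 / f sInf) := by
      rw [hell _ ⟨hs0.trans_le hS.1, hS.2⟩, abs_mul, abs_of_pos (by positivity : 0 < 1 / gam)]
      apply mul_le_mul_of_nonneg_left _ (by positivity)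
      have h2 := abs_le.1 (hFb _ hS)
      have h5 : 0 < 1 / f sInf := by positivity
      rw [abs_le]
      constructor <;> nlinarith [hS.1, hS.2, h2.1, h2.2]
    have h2 := abs_le.1 h1
    rw [abs_le]
    constructor <;> linarith [hM.1, hM.2]
  have hLip : ∀ τ ∈ Set.Ico (0:ℝ) τ₁, 1 - M τ ≤ K * (τ₁ - τ) := by
    intro τ ht
    have h1 : Filter.Tendsto (fun t => M t - M τ) (nhdsWithin τ₁ (Set.Iio τ₁))
        (nhds (1 - M τ)) := hlim.sub_const _
    refine le_of_tendsto h1 ?_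
    filter_upwards [Ioo_mem_nhdsLT ht.2] with t htt
    have h2 := (convex_Ico (0:ℝ) τ₁).norm_image_sub_le_of_norm_hasDerivWithin_le
      (fun x hx => (hode x hx).1) hK ht ⟨ht.1.trans htt.1.le, htt.2⟩
    rw [Real.norm_eq_abs, Real.norm_of_nonneg (by linarith [htt.1])] at h2
    have h3 := le_abs_self (M t - M τ)
    nlinarith [htt.2]
  have hD1 : ∀ᶠ m in nhdsWithin (1:ℝ) (Set.Iio 1),
      LD1 / 2 < (1 - m) ^ b * D m ∧ m ∈ Set.Ioo (1/2:ℝ) 1 :=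
    (hD_one.eventually (lt_mem_nhds (by linarith))).and
      (Ioo_mem_nhdsLT (by norm_num))
  have hlim' : Filter.Tendsto M (nhdsWithin τ₁ (Set.Iio τ₁)) (nhdsWithin 1 (Set.Iio 1)) := by
    refine tendsto_nhdsWithin_iff.2 ⟨hlim, ?_⟩
    filter_upwards [Ioo_mem_nhdsLT hτ] with t ht
    exact (hmem t ⟨ht.1.le, ht.2⟩).1.2
  have hev := hlim'.eventually hD1
  obtain ⟨t0, ht0, hsub⟩ := (mem_nhdsLT_iff_exists_mem_Ico_Ioo_subset hτ).1 hev
  obtain ⟨c, hc, hcdef⟩ : ∃ c : ℝ, 0 < c ∧ c = gam / v * (f sInf * (1/2 * (LD1 / 2 / K))) :=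
    ⟨_, by positivity, rfl⟩
  have hder : ∀ t ∈ Set.Ioo t0 τ₁, HasDerivAt (fun t => S t + c * Real.log (τ₁ - t))
      (gam / v * (f (S t) * (M t * D (M t))) + c * (-1 / (τ₁ - t))) t := by
    intro t ht
    have htI : t ∈ Set.Ico (0:ℝ) τ₁ := ⟨ht0.1.trans ht.1.le, ht.2⟩
    have h1 := (hode t htI).2.hasDerivAt (Ico_mem_nhds (ht0.1.trans_lt ht.1) ht.2)
    have h2 : HasDerivAt (fun t => τ₁ - t) (-1) t := by
      simpa using (hasDerivAt_id t).const_sub τ₁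
    exact h1.add ((h2.log (sub_pos.2 ht.2).ne').const_mul c)
  have hmono : MonotoneOn (fun t => S t + c * Real.log (τ₁ - t)) (Set.Ioo t0 τ₁) := by
    apply monotoneOn_of_deriv_nonneg (convex_Ioo _ _)
    · exact fun t ht => (hder t ht).continuousAt.continuousWithinAt
    · rw [interior_Ioo]
      exact fun t ht => (hder t ht).differentiableAt.differentiableWithinAt
    · rw [interior_Ioo]
      intro t ht
      rw [(hder t ht).deriv]
      have htI : t ∈ Set.Ico (0:ℝ) τ₁ := ⟨ht0.1.trans ht.1.le, ht.2⟩
      obtain ⟨h1, h2, h3⟩ := hsub ht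
      have hp : 0 < τ₁ - t := sub_pos.2 ht.2
      have hq : 0 < 1 - M t := sub_pos.2 h3
      have hDn := hD_nonneg _ (hmem t htI).1
      have h4 : (1 - M t) ^ b ≤ 1 - M t := by
        have := Real.rpow_le_rpow_of_exponent_ge hq (by linarith) hb.le
        rwa [Real.rpow_one] at this
      have h5 : LD1 / 2 ≤ D (M t) * (K * (τ₁ - t)) := by
        have e1 := mul_le_mul_of_nonneg_right h4 hDn
        have e2 := mul_le_mul_of_nonneg_left (hLip t htI) hDn
        linarith
      have h6 : LD1 / 2 / K / (τ₁ - t) ≤ D (M t) := by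
        rw [div_div, div_le_iff₀ (by positivity)]
        exact h5
      have h7 : c / (τ₁ - t) ≤ gam / v * (f (S t) * (M t * D (M t))) := by
        have e : c / (τ₁ - t) = gam / v * (f sInf * (1/2 * (LD1 / 2 / K / (τ₁ - t)))) := by
          rw [hcdef]; ring
        rw [e]
        have := hfge _ (hmem t htI).2
        gcongr
        exact hfpos.le.trans this
      have h8 : c * (-1 / (τ₁ - t)) = - (c / (τ₁ - t)) := by ring
      linarith
  obtain ⟨t2, ht2⟩ := exists_between ht0.2
  have hp : 0 < τ₁ - t2 := sub_pos.2 ht2.2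
  have hE1 : Real.exp (-(2 / c)) < 1 := by
    rw [← Real.exp_zero]
    exact Real.exp_lt_exp.2 (neg_neg_of_pos (by positivity))
  have hE0 := Real.exp_pos (-(2 / c))
  obtain ⟨t3, h3⟩ : ∃ t3, t3 = τ₁ - (τ₁ - t2) * Real.exp (-(2 / c)) := ⟨_, rfl⟩
  have h23 : t2 ≤ t3 := by nlinarith
  have h31 : t3 < τ₁ := by nlinarith
  have hfin := hmono ht2 ⟨ht2.1.trans_le h23, h31⟩ h23
  have hlog : Real.log (τ₁ - t3) = Real.log (τ₁ - t2) - 2 / c := by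
    rw [show τ₁ - t3 = (τ₁ - t2) * Real.exp (-(2 / c)) by rw [h3]; ring,
      Real.log_mul hp.ne' hE0.ne', Real.log_exp]
    ring
  simp only [hlog] at hfin
  have hcc : c * (2 / c) = 2 := by field_simp
  have hA := (hmem t2 ⟨ht0.1.trans ht2.1.le, ht2.2⟩).2.1
  have hB := (hmem t3 ⟨ht0.1.trans (ht2.1.le.trans h23), h31⟩).2.2
  rw [mul_sub, hcc] at hfin
  linarith
end

section
/- Fix v > 0. Let 𝔐̲ : (0,1] → [0,1) be the function defined implicitly by ∫_0^{𝔐̲(s)} D(ρ) ρ^{1−a} dρ = (v²/γ) F(s) (this determines 𝔐̲(s) ∈ [0,1) uniquely for each s ∈ (0,1]). Then there exists s̲ ∈ (0,1), independent of ε, such that for every ε ∈ (0,1) the ε-M-map 𝔐^ε is positive on [s̲,1] and ℓ(s) < 𝔐̲(s) < 𝔐^ε(s) for all s ∈ [s̲, 1). -/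
/-- The ε-M-map: continuous on `[s₋∞,1]`, equal to `ε` at `1`, positive (and `< 1`)
exactly on `(σ,1]`, zero on `[s₋∞,σ]`, and satisfying the integrated ODE
`Φ(𝔐^ε(s)) = Φ(ε) + (v²/γ) ∫_s^1 (𝔐^ε(ρ) − ℓ(ρ))/f(ρ) dρ` on `(σ,1]`. -/
def IsEpsMap (gam v sInf eps sigma : ℝ) (f ell Phi Me : ℝ → ℝ) : Prop :=
  ContinuousOn Me (Set.Icc sInf 1) ∧ Me 1 = eps ∧ sigma ∈ Set.Ico sInf 1 ∧
  (∀ s ∈ Set.Ioc sigma 1, 0 < Me s ∧ Me s < 1) ∧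
  (∀ s ∈ Set.Icc sInf sigma, Me s = 0) ∧
  (∀ s ∈ Set.Ioc sigma 1,
    Phi (Me s) = Phi eps + v ^ 2 / gam * ∫ ρ in s..1, (Me ρ - ell ρ) / f ρ)

open Set Filter Topology MeasureTheory in
lemma aux_g_cont (D : ℝ → ℝ) (a LD0 : ℝ) (ha : 1 < a) (hDc : ContinuousOn D (Ico (0:ℝ) 1))
    (hD_zero : Tendsto (fun m => D m / m ^ a) (𝓝[>] 0) (𝓝 LD0)) :
    ContinuousOn (fun ρ => D ρ * ρ ^ (1 - a)) (Ico (0:ℝ) 1) := by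
  intro x hx
  rcases hx.1.eq_or_lt with h0 | h0
  · subst h0
    have hz : (0:ℝ) ^ (1 - a) = 0 := Real.zero_rpow (by linarith)
    have h1 : Tendsto (fun ρ : ℝ => D ρ * ρ ^ (1 - a)) (𝓝[>] 0) (𝓝 0) := by
      have h2 : Tendsto (fun ρ : ℝ => D ρ / ρ ^ a * ρ) (𝓝[>] 0) (𝓝 (LD0 * 0)) :=
        hD_zero.mul (tendsto_nhdsWithin_of_tendsto_nhds tendsto_id)
      rw [mul_zero] at h2
      refine h2.congr' ?_
      filter_upwards [self_mem_nhdsWithin] with ρ hρ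
      have hρ' : (0:ℝ) < ρ := hρ
      rw [Real.rpow_sub hρ', Real.rpow_one]
      ring
    have h3 : ContinuousWithinAt (fun ρ : ℝ => D ρ * ρ ^ (1 - a)) (Ioi 0) 0 := by
      unfold ContinuousWithinAt
      simpa [hz] using h1
    have h4 : ContinuousWithinAt (fun ρ : ℝ => D ρ * ρ ^ (1 - a)) (Ici 0) 0 :=
      continuousWithinAt_Ioi_iff_Ici.mp h3
    exact h4.mono Ico_subset_Ici_self
  · refine (hDc x hx).mul ?_
    exact (Real.continuousAt_rpow_const x (1 - a) (Or.inl h0.ne')).continuousWithinAt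

open Set Filter Topology MeasureTheory in
lemma aux_D_pos (D : ℝ → ℝ) (a LD0 : ℝ) (hLD0 : 0 < LD0)
    (hD_mono : MonotoneOn D (Ico (0:ℝ) 1))
    (hD_zero : Tendsto (fun m => D m / m ^ a) (𝓝[>] 0) (𝓝 LD0)) :
    ∀ x ∈ Ioo (0:ℝ) 1, 0 < D x := by
  intro x hx
  have h1 := hD_zero.eventually (lt_mem_nhds hLD0)
  have h2 : ∀ᶠ m in 𝓝[>] (0:ℝ), m ∈ Ioo 0 x := Ioo_mem_nhdsGT hx.1
  obtain ⟨m, hm, hm2⟩ := (h1.and h2).exists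
  have : 0 < D m := by
    have hp := Real.rpow_pos_of_pos hm2.1 a
    have := mul_pos hm hp
    rwa [div_mul_cancel₀ _ hp.ne'] at this
  exact this.trans_le (hD_mono ⟨hm2.1.le, hm2.2.trans hx.2⟩ ⟨hx.1.le, hx.2⟩ hm2.2.le)

open Set Filter Topology MeasureTheory in
lemma aux_ii (h : ℝ → ℝ) (hc : ContinuousOn h (Ico (0:ℝ) 1)) {x y : ℝ}
    (hx : x ∈ Ico (0:ℝ) 1) (hy : y ∈ Ico (0:ℝ) 1) : IntervalIntegrable h volume x y :=
  (hc.mono (ordConnected_Ico.uIcc_subset hx hy)).intervalIntegrable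

open Set Filter Topology MeasureTheory in
lemma aux_strict (h : ℝ → ℝ) (hc : ContinuousOn h (Ico (0:ℝ) 1)) (hp : ∀ x ∈ Ioo (0:ℝ) 1, 0 < h x) :
    StrictMonoOn (fun m => ∫ ρ in (0:ℝ)..m, h ρ) (Ico (0:ℝ) 1) := by
  intro x hx y hy hxy
  have h0 : (0:ℝ) ∈ Ico (0:ℝ) 1 := by simp
  have h1 := intervalIntegral.integral_interval_sub_left (aux_ii h hc h0 hy) (aux_ii h hc h0 hx)
  have h2 : 0 < ∫ ρ in x..y, h ρ :=
    intervalIntegral.intervalIntegral_pos_of_pos_on (aux_ii h hc hx hy)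
      (fun z hz => hp z ⟨hx.1.trans_lt hz.1, hz.2.trans hy.2⟩) hxy
  show (∫ ρ in (0:ℝ)..x, h ρ) < ∫ ρ in (0:ℝ)..y, h ρ
  linarith

open Set Filter Topology MeasureTheory in
lemma aux_prim_cont (h : ℝ → ℝ) (hc : ContinuousOn h (Ico (0:ℝ) 1)) :
    ContinuousOn (fun m => ∫ ρ in (0:ℝ)..m, h ρ) (Ico (0:ℝ) 1) := by
  intro x hx
  obtain ⟨y, hxy, hy⟩ := exists_between hx.2
  have hy0 : (0:ℝ) ≤ y := hx.1.trans hxy.le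
  have h1 : ContinuousOn (fun m => ∫ ρ in (0:ℝ)..m, h ρ) (Icc 0 y) := by
    have := intervalIntegral.continuousOn_primitive_interval (μ := volume) (f := h) (a := 0) (b := y) ?_
    · rwa [uIcc_of_le hy0] at this
    · rw [uIcc_of_le hy0]
      exact (hc.mono (fun z hz => ⟨hz.1, hz.2.trans_lt hy⟩)).integrableOn_Icc
  refine (h1 x ⟨hx.1, hxy.le⟩).mono_of_mem_nhdsWithin ?_
  have : Iio y ∈ 𝓝 x := Iio_mem_nhds hxy
  filter_upwards [self_mem_nhdsWithin, mem_nhdsWithin_of_mem_nhds this] with z hz hz2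
  exact ⟨hz.1, le_of_lt hz2⟩

open Set Filter Topology MeasureTheory in
lemma aux_F_cont (h : ℝ → ℝ) (hc : ContinuousOn h (Ioc (0:ℝ) 1)) (p : ℝ) (hp : p ∈ Ioo (0:ℝ) 1) :
    ContinuousOn (fun s => ∫ ρ in s..1, h ρ) (Icc p 1) := by
  have := intervalIntegral.continuousOn_primitive_interval_left (μ := volume) (f := h) (a := p) (b := 1) ?_
  · rwa [uIcc_of_le hp.2.le] at this
  · rw [uIcc_of_le hp.2.le]
    exact (hc.mono (fun z hz => ⟨hp.1.trans_le hz.1, hz.2⟩)).integrableOn_Icc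

lemma aux_sub_right {h : ℝ → ℝ} {x y z : ℝ} (h1 : IntervalIntegrable h MeasureTheory.volume x z)
    (h2 : IntervalIntegrable h MeasureTheory.volume y z) :
    (∫ ρ in x..z, h ρ) - (∫ ρ in y..z, h ρ) = ∫ ρ in x..y, h ρ := by
  have := intervalIntegral.integral_add_adjacent_intervals (h1.trans h2.symm) h2
  linarith

open Set Filter Topology MeasureTheory in
lemma aux_key (D : ℝ → ℝ) (a : ℝ) (ha : 1 < a) (hDc : ContinuousOn D (Ico (0:ℝ) 1))
    (hD_nonneg : ∀ m ∈ Ico (0:ℝ) 1, 0 ≤ D m)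
    (hg : ContinuousOn (fun ρ => D ρ * ρ ^ (1 - a)) (Ico (0:ℝ) 1))
    (x y : ℝ) (hx : x ∈ Ico (0:ℝ) 1) (hy : y ∈ Ico (0:ℝ) 1) (hxy : x ≤ y) :
    (∫ ρ in x..y, ρ * D ρ) ≤ y ^ a * ∫ ρ in x..y, D ρ * ρ ^ (1 - a) := by
  rw [← intervalIntegral.integral_const_mul]
  refine intervalIntegral.integral_mono_on hxy
    (aux_ii _ (continuousOn_id.mul hDc) hx hy) ((aux_ii _ hg hx hy).const_mul _) ?_
  intro z hz
  have hz0 : 0 ≤ z := hx.1.trans hz.1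
  have hD := hD_nonneg z ⟨hz0, hz.2.trans_lt hy.2⟩
  rcases hz0.eq_or_lt with h0 | h0
  · subst h0
    have hz : (0:ℝ) ^ (1 - a) = 0 := Real.zero_rpow (by linarith)
    simp [hz]
  · have e : z * D z = z ^ a * (D z * z ^ (1 - a)) := by
      have : z ^ a * z ^ (1 - a) = z := by
        rw [← Real.rpow_add h0]; simp
      calc z * D z = (z ^ a * z ^ (1 - a)) * D z := by rw [this]
        _ = _ := by ring
    rw [e]
    exact mul_le_mul_of_nonneg_right (Real.rpow_le_rpow hz0 hz.2 (by linarith))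
      (mul_nonneg hD (Real.rpow_nonneg hz0 _))

set_option maxHeartbeats 2000000 in
theorem lower_bound_for_eps_maps
    (lam gam kap : ℝ)
    (hlam : lam ∈ Set.Ioo (0:ℝ) 1) (hgam : gam ∈ Set.Ioo (0:ℝ) 1)
    (hkap : kap ∈ Set.Ioc (0:ℝ) 1)
    (f f' F : ℝ → ℝ)
    (hf_maps : ∀ x ∈ Set.Icc (0:ℝ) 1, f x ∈ Set.Icc (0:ℝ) 1)
    (hf_mono : StrictMonoOn f (Set.Icc (0:ℝ) 1))
    (hf_deriv : ∀ x ∈ Set.Icc (0:ℝ) 1, HasDerivWithinAt f (f' x) (Set.Icc (0:ℝ) 1) x)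
    (hf'_cont : ContinuousOn f' (Set.Icc (0:ℝ) 1))
    (hf_zero : f 0 = 0) (hf'_zero : f' 0 = 1 / kap)
    (hf_one : f 1 ∈ Set.Ioc lam 1)
    (hF : ∀ s ∈ Set.Ioc (0:ℝ) 1, F s = ∫ ρ in s..1, 1 / f ρ)
    (D : ℝ → ℝ) (a b : ℝ) (ha : 1 < a) (hb : 1 < b)
    (hD_mono : MonotoneOn D (Set.Ico (0:ℝ) 1))
    (hD_nonneg : ∀ m ∈ Set.Ico (0:ℝ) 1, 0 ≤ D m)
    (hD_smooth : ∃ D' : ℝ → ℝ, ContinuousOn D' (Set.Ico (0:ℝ) 1) ∧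
      ∀ m ∈ Set.Ico (0:ℝ) 1, HasDerivWithinAt D (D' m) (Set.Ico (0:ℝ) 1) m)
    (LD0 LD1 : ℝ) (hLD0 : 0 < LD0) (hLD1 : 0 < LD1)
    (hD_zero : Filter.Tendsto (fun m => D m / m ^ a) (nhdsWithin 0 (Set.Ioi 0)) (nhds LD0))
    (hD_one : Filter.Tendsto (fun m => (1 - m) ^ b * D m) (nhdsWithin 1 (Set.Iio 1)) (nhds LD1))
    (ell : ℝ → ℝ)
    (hell : ∀ s ∈ Set.Ioc (0:ℝ) 1, ell s = 1 / gam * ((1 - s) - lam * F s))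
    (sInf : ℝ) (hsInf_mem : sInf ∈ Set.Ioo (0:ℝ) 1)
    (hsInf_eq : sInf + lam * F sInf = 1)
    (hsInf_uniq : ∀ s ∈ Set.Ioo (0:ℝ) 1, s + lam * F s = 1 → s = sInf)
    (sM : ℝ) (hsM_mem : sM ∈ Set.Ioo (0:ℝ) 1) (hsM_eq : f sM = lam)
    (hpar : sM + lam * F sM < 1 - gam)
    (Phi : ℝ → ℝ)
    (hPhi : ∀ m ∈ Set.Ico (0:ℝ) 1, Phi m = ∫ ρ in (0:ℝ)..m, ρ * D ρ)
    (v : ℝ) (hv : 0 < v)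
    (Mlow : ℝ → ℝ)
    (hMlow : ∀ s ∈ Set.Ioc (0:ℝ) 1, Mlow s ∈ Set.Ico (0:ℝ) 1 ∧
      (∫ ρ in (0:ℝ)..(Mlow s), D ρ * ρ ^ (1 - a)) = v ^ 2 / gam * F s) :
    ∃ sl ∈ Set.Ioo (0:ℝ) 1, ∀ eps ∈ Set.Ioo (0:ℝ) 1, ∀ sigma Me,
      IsEpsMap gam v sInf eps sigma f ell Phi Me →
        (∀ s ∈ Set.Icc sl 1, 0 < Me s) ∧
        (∀ s ∈ Set.Ico sl 1, ell s < Mlow s ∧ Mlow s < Me s) := by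
  classical
  obtain ⟨D', -, hD'⟩ := hD_smooth
  have hDc : ContinuousOn D (Set.Ico (0:ℝ) 1) := fun x hx => (hD' x hx).continuousWithinAt
  have hfc : ContinuousOn f (Set.Icc (0:ℝ) 1) := fun x hx => (hf_deriv x hx).continuousWithinAt
  have hDpos := aux_D_pos D a LD0 hLD0 hD_mono hD_zero
  have hg := aux_g_cont D a LD0 ha hDc hD_zero
  have hgpos : ∀ x ∈ Set.Ioo (0:ℝ) 1, 0 < D x * x ^ (1 - a) := fun x hx =>
    mul_pos (hDpos x hx) (Real.rpow_pos_of_pos hx.1 _)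
  have hzc : ContinuousOn (fun ρ => ρ * D ρ) (Set.Ico (0:ℝ) 1) := continuousOn_id.mul hDc
  have hzpos : ∀ x ∈ Set.Ioo (0:ℝ) 1, 0 < x * D x := fun x hx => mul_pos hx.1 (hDpos x hx)
  have h00 : (0:ℝ) ∈ Set.Ico (0:ℝ) 1 := by simp
  obtain ⟨G, hG⟩ : ∃ G : ℝ → ℝ, G = fun m => ∫ ρ in (0:ℝ)..m, D ρ * ρ ^ (1 - a) := ⟨_, rfl⟩
  have hGm : StrictMonoOn G (Set.Ico (0:ℝ) 1) := hG ▸ aux_strict _ hg hgpos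
  have hGc : ContinuousOn G (Set.Ico (0:ℝ) 1) := hG ▸ aux_prim_cont _ hg
  have hG0 : G 0 = 0 := by simp [hG]
  have hPm : StrictMonoOn Phi (Set.Ico (0:ℝ) 1) := by
    intro x hx y hy hxy
    rw [hPhi x hx, hPhi y hy]
    exact aux_strict _ hzc hzpos hx hy hxy
  have hkey : ∀ x ∈ Set.Ico (0:ℝ) 1, ∀ y ∈ Set.Ico (0:ℝ) 1, x ≤ y →
      Phi y - Phi x ≤ y ^ a * (G y - G x) := by
    intro x hx y hy hxy
    rw [hPhi x hx, hPhi y hy, hG]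
    show _ ≤ y ^ a * ((∫ ρ in (0:ℝ)..y, D ρ * ρ ^ (1 - a)) - ∫ ρ in (0:ℝ)..x, D ρ * ρ ^ (1 - a))
    rw [intervalIntegral.integral_interval_sub_left (aux_ii _ hzc h00 hy) (aux_ii _ hzc h00 hx),
      intervalIntegral.integral_interval_sub_left (aux_ii _ hg h00 hy) (aux_ii _ hg h00 hx)]
    exact aux_key D a ha hDc hD_nonneg hg x y hx hy hxy
  have hfpos : ∀ x ∈ Set.Ioc (0:ℝ) 1, 0 < f x := fun x hx => by
    have := hf_mono (a := 0) (by simp) ⟨hx.1.le, hx.2⟩ hx.1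
    rwa [hf_zero] at this
  have hfic : ContinuousOn (fun ρ => 1 / f ρ) (Set.Ioc (0:ℝ) 1) :=
    continuousOn_const.div (hfc.mono Set.Ioc_subset_Icc_self) (fun x hx => (hfpos x hx).ne')
  have hii : ∀ h : ℝ → ℝ, ∀ p ∈ Set.Ioc (0:ℝ) 1, ContinuousOn h (Set.Icc p 1) →
      ∀ x ∈ Set.Icc p 1, ∀ y ∈ Set.Icc p 1, IntervalIntegrable h MeasureTheory.volume x y := by
    intro h p hp hc x hx y hy
    exact (hc.mono (Set.ordConnected_Icc.uIcc_subset hx hy)).intervalIntegrable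
  have hFsub : ∀ x ∈ Set.Ioc (0:ℝ) 1, ∀ y ∈ Set.Ioc (0:ℝ) 1, x ≤ y →
      F x - F y = ∫ ρ in x..y, 1 / f ρ := by
    intro x hx y hy hxy
    rw [hF x hx, hF y hy]
    have hc : ContinuousOn (fun ρ => 1 / f ρ) (Set.Icc x 1) :=
      hfic.mono (fun z hz => ⟨hx.1.trans_le hz.1, hz.2⟩)
    exact aux_sub_right
      (hii _ x hx hc x ⟨le_rfl, hx.2⟩ 1 ⟨hx.2, le_rfl⟩)
      (hii _ x hx hc y ⟨hxy, hy.2⟩ 1 ⟨hx.2, le_rfl⟩)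
  have hF1 : F 1 = 0 := by rw [hF 1 (by simp)]; simp
  have hFlow : ∀ x ∈ Set.Ioc (0:ℝ) 1, ∀ y ∈ Set.Ioc (0:ℝ) 1, x ≤ y → y - x ≤ F x - F y := by
    intro x hx y hy hxy
    rw [hFsub x hx y hy hxy]
    have hc : ContinuousOn (fun ρ => 1 / f ρ) (Set.Icc x 1) :=
      hfic.mono (fun z hz => ⟨hx.1.trans_le hz.1, hz.2⟩)
    have := intervalIntegral.integral_mono_on (f := fun _ => (1:ℝ)) (g := fun ρ => 1 / f ρ) hxy
      (by simp) (hii _ x hx hc x ⟨le_rfl, hx.2⟩ y ⟨hxy, hy.2⟩) (μ := MeasureTheory.volume) ?_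
    · simpa using this
    · intro z hz
      have hz' : z ∈ Set.Ioc (0:ℝ) 1 := ⟨hx.1.trans_le hz.1, hz.2.trans hy.2⟩
      exact (one_le_div (hfpos z hz')).2 (hf_maps z ⟨hz'.1.le, hz'.2⟩).2
  have hFc : ∀ p ∈ Set.Ioo (0:ℝ) 1, ContinuousOn F (Set.Icc p 1) := by
    intro p hp
    exact (aux_F_cont _ hfic p hp).congr (fun z hz => hF z ⟨hp.1.trans_le hz.1, hz.2⟩)
  have hellc : ∀ p ∈ Set.Ioo (0:ℝ) 1, ContinuousOn ell (Set.Icc p 1) := by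
    intro p hp
    have : ContinuousOn (fun s => 1 / gam * ((1 - s) - lam * F s)) (Set.Icc p 1) :=
      continuousOn_const.mul ((continuousOn_const.sub continuousOn_id).sub
        (continuousOn_const.mul (hFc p hp)))
    exact this.congr (fun z hz => hell z ⟨hp.1.trans_le hz.1, hz.2⟩)
  obtain ⟨c, hc⟩ : ∃ c, c = v ^ 2 / gam := ⟨_, rfl⟩
  have hcpos : 0 < c := by rw [hc]; exact div_pos (by positivity) hgam.1
  rw [← hc] at hMlow
  have hGM : ∀ s ∈ Set.Ioc (0:ℝ) 1, G (Mlow s) = c * F s := fun s hs => by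
    rw [hG]; exact (hMlow s hs).2
  -- choice of δ
  obtain ⟨δ, hδ, hδ1, hδa, hδl, hδg⟩ : ∃ δ : ℝ, 0 < δ ∧ δ < 1 ∧ δ ^ (a - 1) ≤ 1 / 2 ∧
      δ * (LD0 / (c * gam)) ≤ 1 / 2 ∧ ∀ ρ ∈ Set.Ioo 0 δ, D ρ * ρ ^ (1 - a) ≤ 2 * LD0 * ρ := by
    have e1 := hD_zero.eventually (gt_mem_nhds (show LD0 < 2 * LD0 by linarith))
    obtain ⟨u, hu, hu2⟩ := mem_nhdsGT_iff_exists_Ioo_subset.1 e1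
    have e2 : ∀ᶠ m in nhdsWithin (0:ℝ) (Set.Ioi 0), m < u :=
      Filter.mem_of_superset (Ioo_mem_nhdsGT hu) (fun z hz => hz.2)
    have e3 : ∀ᶠ m in nhdsWithin (0:ℝ) (Set.Ioi 0), m < 1 :=
      Filter.mem_of_superset (Ioo_mem_nhdsGT one_pos) (fun z hz => hz.2)
    have e4 : ∀ᶠ m in nhdsWithin (0:ℝ) (Set.Ioi 0), m ^ (a - 1) < 1 / 2 := by
      have : Filter.Tendsto (fun m : ℝ => m ^ (a - 1)) (nhds 0) (nhds ((0:ℝ) ^ (a - 1))) :=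
        Real.continuousAt_rpow_const 0 (a - 1) (Or.inr (by linarith))
      rw [Real.zero_rpow (by linarith)] at this
      exact (this.mono_left nhdsWithin_le_nhds).eventually (gt_mem_nhds (by norm_num))
    have e5 : ∀ᶠ m in nhdsWithin (0:ℝ) (Set.Ioi 0), m * (LD0 / (c * gam)) < 1 / 2 := by
      have : Filter.Tendsto (fun m : ℝ => m * (LD0 / (c * gam))) (nhds 0)
          (nhds (0 * (LD0 / (c * gam)))) := Filter.tendsto_id.mul_const _
      rw [zero_mul] at this
      exact (this.mono_left nhdsWithin_le_nhds).eventually (gt_mem_nhds (by norm_num))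
    obtain ⟨δ, ⟨⟨⟨hd1, hd2⟩, hd3⟩, hd4⟩, hd5⟩ :=
      ((((e2.and e3).and e4).and e5).and self_mem_nhdsWithin).exists
    refine ⟨δ, hd5, hd2, hd3.le, hd4.le, ?_⟩
    intro ρ hρ
    have h1 : D ρ / ρ ^ a < 2 * LD0 := hu2 ⟨hρ.1, hρ.2.trans hd1⟩
    have h2 : D ρ * ρ ^ (1 - a) = D ρ / ρ ^ a * ρ := by
      rw [Real.rpow_sub hρ.1, Real.rpow_one]; ring
    rw [h2]
    exact mul_le_mul_of_nonneg_right h1.le hρ.1.le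
  have hδI : δ ∈ Set.Ico (0:ℝ) 1 := ⟨hδ.le, hδ1⟩
  have hGδ : 0 < G δ := by
    have := hGm h00 hδI hδ
    rwa [hG0] at this
  have hGup : ∀ m ∈ Set.Ioo 0 δ, G m ≤ LD0 * m ^ 2 := by
    intro m hm
    have hmI : m ∈ Set.Ico (0:ℝ) 1 := ⟨hm.1.le, hm.2.trans hδ1⟩
    have h1 := intervalIntegral.integral_mono_on_of_le_Ioo (μ := MeasureTheory.volume)
      (g := fun ρ => 2 * LD0 * ρ) hm.1.le (aux_ii _ hg h00 hmI)
      ((continuous_const.mul continuous_id).intervalIntegrable _ _)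
      (fun ρ hρ => hδg ρ ⟨hρ.1, hρ.2.trans hm.2⟩)
    rw [intervalIntegral.integral_const_mul, integral_id] at h1
    rw [hG]
    show (∫ ρ in (0:ℝ)..m, D ρ * ρ ^ (1 - a)) ≤ _
    linarith
  -- choice of sl
  obtain ⟨sl, hsl, hslF⟩ : ∃ sl ∈ Set.Ioo (0:ℝ) 1, c * F sl < G δ := by
    have h1 : ContinuousWithinAt F (Set.Icc (1/2) 1) 1 :=
      hFc (1/2) ⟨by norm_num, by norm_num⟩ 1 ⟨by norm_num, le_rfl⟩
    have h2 : Filter.Tendsto (fun s => c * F s) (nhdsWithin 1 (Set.Ioo (1/2) 1)) (nhds (c * F 1)) :=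
      (h1.mono Set.Ioo_subset_Icc_self).tendsto.const_mul c
    rw [hF1, mul_zero, nhdsWithin_Ioo_eq_nhdsLT (by norm_num)] at h2
    have h3 := h2.eventually (gt_mem_nhds hGδ)
    have h4 : ∀ᶠ s in nhdsWithin (1:ℝ) (Set.Iio 1), s ∈ Set.Ioo (0:ℝ) 1 :=
      Ioo_mem_nhdsLT one_pos
    obtain ⟨s, hs, hs2⟩ := (h3.and h4).exists
    exact ⟨s, hs2, hs⟩
  have hMprop : ∀ s ∈ Set.Ico sl 1, 0 < Mlow s ∧ Mlow s < δ := by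
    intro s hs
    have hs' : s ∈ Set.Ioc (0:ℝ) 1 := ⟨hsl.1.trans_le hs.1, hs.2.le⟩
    have hF0 : 0 < F s := by
      have := hFlow s hs' 1 (by simp) hs.2.le
      rw [hF1] at this
      linarith [hs.2]
    constructor
    · rw [← hGm.lt_iff_lt h00 (hMlow s hs').1, hG0, hGM s hs']
      positivity
    · rw [← hGm.lt_iff_lt (hMlow s hs').1 hδI, hGM s hs']
      have := hFlow sl ⟨hsl.1, hsl.2.le⟩ s hs' hs.1
      have h2 : F s ≤ F sl := by linarith [hs.1]
      nlinarith
  have hMell : ∀ s ∈ Set.Ico sl 1, ell s < Mlow s / 2 ∧ Mlow s ^ a < Mlow s - ell s := by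
    intro s hs
    have hs' : s ∈ Set.Ioc (0:ℝ) 1 := ⟨hsl.1.trans_le hs.1, hs.2.le⟩
    obtain ⟨h0, h1⟩ := hMprop s hs
    have hFs : 1 - s ≤ F s := by
      have := hFlow s hs' 1 (by simp) hs.2.le
      rw [hF1] at this
      linarith
    have h2 := hGup _ ⟨h0, h1⟩
    rw [hGM s hs'] at h2
    have hcg : 0 < c * gam := mul_pos hcpos hgam.1
    have h3 : ell s < 1 / gam * (1 - s) := by
      rw [hell s hs']
      have : 0 < lam * F s := mul_pos hlam.1 (by linarith [hs.2])
      have hg' : 0 < 1 / gam := one_div_pos.2 hgam.1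
      nlinarith
    have h4 : 1 / gam * (1 - s) ≤ (LD0 / (c * gam)) * Mlow s ^ 2 := by
      rw [div_mul_eq_mul_div, div_mul_eq_mul_div, div_le_div_iff₀ hgam.1 hcg]
      have : c * (1 - s) ≤ LD0 * Mlow s ^ 2 := le_trans (mul_le_mul_of_nonneg_left hFs hcpos.le) h2
      nlinarith [hgam.1]
    have h5 : (LD0 / (c * gam)) * Mlow s ^ 2 ≤ Mlow s / 2 := by
      have hk : 0 < LD0 / (c * gam) := div_pos hLD0 hcg
      have : Mlow s * (LD0 / (c * gam)) ≤ 1 / 2 :=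
        le_trans (mul_le_mul_of_nonneg_right h1.le hk.le) hδl
      nlinarith
    have h6 : ell s < Mlow s / 2 := by linarith
    refine ⟨h6, ?_⟩
    have h7 : Mlow s ^ a = Mlow s ^ (a - 1) * Mlow s := by
      rw [Real.rpow_sub_one h0.ne', div_mul_cancel₀ _ h0.ne']
    have h8 : Mlow s ^ (a - 1) ≤ 1 / 2 :=
      le_trans (Real.rpow_le_rpow h0.le h1.le (by linarith)) hδa
    rw [h7]
    nlinarith
  refine ⟨sl, hsl, ?_⟩
  intro eps heps sigma Me hMe
  obtain ⟨hMec, hMe1, hsig, hMepos, hMezero, hMeint⟩ := hMe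
  rw [← hc] at hMeint
  have hsig0 : 0 < sigma := hsInf_mem.1.trans_le hsig.1
  have hMesig : Me sigma = 0 := hMezero sigma ⟨hsig.1, le_rfl⟩
  obtain ⟨p, hp⟩ : ∃ p, p = max sl sigma := ⟨_, rfl⟩
  have hpsl : sl ≤ p := hp ▸ le_max_left _ _
  have hpsig : sigma ≤ p := hp ▸ le_max_right _ _
  have hp1 : p < 1 := hp ▸ max_lt hsl.2 hsig.2
  have hp0 : 0 < p := hsl.1.trans_le hpsl
  have hpI : p ∈ Set.Ioo (0:ℝ) 1 := ⟨hp0, hp1⟩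
  have hMeI : ∀ s ∈ Set.Icc p 1, Me s ∈ Set.Ico (0:ℝ) 1 := by
    intro s hs
    rcases (hpsig.trans hs.1).eq_or_lt with h | h
    · rw [← h, hMesig]; exact h00
    · have := hMepos s ⟨h, hs.2⟩
      exact ⟨this.1.le, this.2⟩
  have hMecp : ContinuousOn Me (Set.Icc p 1) :=
    hMec.mono (Set.Icc_subset_Icc_left (hsig.1.trans hpsig))
  obtain ⟨H, hH⟩ : ∃ H : ℝ → ℝ, H = fun s => G (Me s) - c * F s := ⟨_, rfl⟩
  have hHe : ∀ s, H s = G (Me s) - c * F s := fun s => by rw [hH]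
  have hHc : ContinuousOn H (Set.Icc p 1) := by
    rw [hH]
    exact (hGc.comp hMecp hMeI).sub (continuousOn_const.mul (hFc p hpI))
  have hHlt : ∀ s ∈ Set.Icc p 1, 0 < H s → Mlow s < Me s := by
    intro s hs h
    have hs' : s ∈ Set.Ioc (0:ℝ) 1 := ⟨hp0.trans_le hs.1, hs.2⟩
    rw [← hGm.lt_iff_lt (hMlow s hs').1 (hMeI s hs), hGM s hs']
    rw [hHe] at h
    linarith
  have hH1 : 0 < H 1 := by
    rw [hHe, hMe1, hF1]
    have := hGm h00 ⟨heps.1.le, heps.2⟩ heps.1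
    rw [hG0] at this
    linarith
  have hmain : ∀ s ∈ Set.Icc p 1, 0 < H s := by
    by_contra hcon
    push Not at hcon
    obtain ⟨t, ht, htH⟩ := hcon
    have hScl : IsCompact (Set.Icc p 1 ∩ H ⁻¹' Set.Iic 0) :=
      isCompact_Icc.of_isClosed_subset (hHc.preimage_isClosed_of_isClosed isClosed_Icc isClosed_Iic)
        Set.inter_subset_left
    obtain ⟨s0, hs0, hs0max⟩ := hScl.exists_isGreatest ⟨t, ht, htH⟩
    have hs0H : H s0 ≤ 0 := hs0.2
    have hs0p := hs0.1
    have hs01 : s0 < 1 := by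
      rcases hs0p.2.eq_or_lt with h | h
      · rw [h] at hs0H; linarith
      · exact h
    have hgt : ∀ s ∈ Set.Ioc s0 1, 0 < H s := by
      intro s hs
      by_contra h
      have := hs0max ⟨⟨hs0p.1.trans hs.1.le, hs.2⟩, not_lt.1 h⟩
      exact absurd hs.1 (not_lt.2 this)
    have hs0I : s0 ∈ Set.Ioc (0:ℝ) 1 := ⟨hp0.trans_le hs0p.1, hs0p.2⟩
    have hs0sl : s0 ∈ Set.Ico sl 1 := ⟨hpsl.trans hs0p.1, hs01⟩
    have hH0 : 0 ≤ H s0 := by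
      have h1 : Filter.Tendsto H (nhdsWithin s0 (Set.Ioo s0 1)) (nhds (H s0)) :=
        (hHc s0 hs0p).mono (fun z hz => ⟨hs0p.1.trans hz.1.le, hz.2.le⟩)
      rw [nhdsWithin_Ioo_eq_nhdsGT hs01] at h1
      refine ge_of_tendsto h1 ?_
      filter_upwards [Ioo_mem_nhdsGT hs01] with z hz
      exact (hgt z ⟨hz.1, hz.2.le⟩).le
    have hEq : Me s0 = Mlow s0 := by
      have h := le_antisymm hs0H hH0
      rw [hHe] at h
      refine hGm.injOn (hMeI s0 hs0p) (hMlow s0 hs0I).1 ?_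
      rw [hGM s0 hs0I]; linarith
    have hsigs0 : sigma < s0 := by
      rcases (hpsig.trans hs0p.1).eq_or_lt with h | h
      · have := (hMprop s0 hs0sl).1
        rw [← hEq, ← h, hMesig] at this
        exact absurd this (lt_irrefl _)
      · exact h
    have hdc : ContinuousOn (fun s => Me s - ell s) (Set.Icc p 1) := hMecp.sub (hellc p hpI)
    obtain ⟨s, hs, hsb⟩ : ∃ s ∈ Set.Ioo s0 1, ∀ ρ ∈ Set.Icc s0 s, Mlow s0 ^ a ≤ Me ρ - ell ρ := by
      have h1 : Filter.Tendsto (fun s => Me s - ell s) (nhdsWithin s0 (Set.Ico s0 1))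
          (nhds (Me s0 - ell s0)) :=
        (hdc s0 hs0p).mono (fun z hz => ⟨hs0p.1.trans hz.1, hz.2.le⟩)
      rw [nhdsWithin_Ico_eq_nhdsGE hs01] at h1
      have h2 := h1.eventually (lt_mem_nhds (show Mlow s0 ^ a < Me s0 - ell s0 by
        rw [hEq]; exact (hMell s0 hs0sl).2))
      obtain ⟨u, hu, hu2⟩ := mem_nhdsGE_iff_exists_Icc_subset.1 h2
      have hu' : s0 < u := hu
      obtain ⟨w, hw1, hw2⟩ := exists_between (lt_min hu' hs01)
      refine ⟨w, ⟨hw1, hw2.trans_le (min_le_right _ _)⟩, fun ρ hρ => ?_⟩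
      exact le_of_lt (hu2 ⟨hρ.1, hρ.2.trans (hw2.le.trans (min_le_left _ _))⟩)
    have hsp : s ∈ Set.Icc p 1 := ⟨hs0p.1.trans hs.1.le, hs.2.le⟩
    have hsI : s ∈ Set.Ioc (0:ℝ) 1 := ⟨hp0.trans_le hsp.1, hsp.2⟩
    have hpc : p ∈ Set.Ioc (0:ℝ) 1 := ⟨hp0, hp1.le⟩
    have h1p : (1:ℝ) ∈ Set.Icc p 1 := ⟨hp1.le, le_rfl⟩
    have hqc : ContinuousOn (fun ρ => (Me ρ - ell ρ) / f ρ) (Set.Icc p 1) :=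
      hdc.div (hfc.mono (Set.Icc_subset_Icc_left hp0.le))
        (fun z hz => (hfpos z ⟨hp0.trans_le hz.1, hz.2⟩).ne')
    have hfp : ContinuousOn (fun ρ => 1 / f ρ) (Set.Icc p 1) :=
      hfic.mono (fun z hz => ⟨hp0.trans_le hz.1, hz.2⟩)
    have i1 : Phi (Me s0) - Phi (Me s) = c * ∫ ρ in s0..s, (Me ρ - ell ρ) / f ρ := by
      rw [hMeint s0 ⟨hsigs0, hs01.le⟩, hMeint s ⟨hsigs0.trans hs.1, hs.2.le⟩,
        ← aux_sub_right (hii _ p hpc hqc s0 hs0p 1 h1p)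
          (hii _ p hpc hqc s hsp 1 h1p)]
      ring
    have i2 : Mlow s0 ^ a * (F s0 - F s) ≤ ∫ ρ in s0..s, (Me ρ - ell ρ) / f ρ := by
      rw [hFsub s0 hs0I s hsI hs.1.le, ← intervalIntegral.integral_const_mul]
      refine intervalIntegral.integral_mono_on hs.1.le
        ((hii _ p hpc hfp s0 hs0p s hsp).const_mul _) (hii _ p hpc hqc s0 hs0p s hsp) ?_
      intro z hz
      rw [mul_one_div]
      exact div_le_div_of_nonneg_right (hsb z hz)
        (hfpos z ⟨hs0I.1.trans_le hz.1, hz.2.trans hs.2.le⟩).le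
    have hMM : Mlow s ≤ Mlow s0 := by
      rw [← hGm.le_iff_le (hMlow s hsI).1 (hMlow s0 hs0I).1, hGM s hsI, hGM s0 hs0I]
      have := hFlow s0 hs0I s hsI hs.1.le
      have h2 : F s ≤ F s0 := by linarith [hs.1]
      exact mul_le_mul_of_nonneg_left h2 hcpos.le
    have i3 := hkey _ (hMlow s hsI).1 _ (hMlow s0 hs0I).1 hMM
    rw [hGM s hsI, hGM s0 hs0I] at i3
    have i4 := mul_le_mul_of_nonneg_left i2 hcpos.le
    have i5 := hPm (hMlow s hsI).1 (hMeI s hsp) (hHlt s hsp (hgt s ⟨hs.1, hs.2.le⟩))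
    rw [hEq] at i1
    have i6 : Mlow s0 ^ a * (c * F s0 - c * F s) = c * (Mlow s0 ^ a * (F s0 - F s)) := by ring
    linarith
  have hsigsl : sigma < sl := by
    by_contra h
    have hps : p = sigma := by rw [hp]; exact max_eq_right (not_lt.1 h)
    have h1 := hHlt p ⟨le_rfl, hp1.le⟩ (hmain p ⟨le_rfl, hp1.le⟩)
    have h2 := (hMprop p ⟨hpsl, hp1⟩).1
    rw [hps, hMesig] at h1
    rw [hps] at h2
    linarith
  have hpe : p = sl := by rw [hp]; exact max_eq_left hsigsl.le
  rw [hpe] at hmain hHlt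
  refine ⟨fun s hs => (hMepos s ⟨hsigsl.trans_le hs.1, hs.2⟩).1, fun s hs => ⟨?_, ?_⟩⟩
  · have h1 := (hMell s hs).1
    have h2 := (hMprop s hs).1
    linarith
  · exact hHlt s ⟨hs.1, hs.2.le⟩ (hmain s ⟨hs.1, hs.2.le⟩)
end

section
/- Let v > 0 and let (M,S) be a travelling-wave solution with speed v such that M > 0 on (−δ, 0) for some δ > 0. Then, as ξ → 0⁻, the flux D(M(ξ)) M'(ξ) tends to 0 and the particle speed −(D(M(ξ))/M(ξ)) M'(ξ) tends to v; equivalently, ℓ(S(ξ))/M(ξ) → 0 as ξ → 0⁻. -/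
/-- A travelling-wave solution with speed `v`: `(M,S) : ℝ → [0,1) × (0,1]`,
`S` is `C¹` with `S' = (γ/v) f(S) M`, `M` is continuous and wherever `M > 0` it is
differentiable with `D(M) M' = (v/γ)((1 − S − λF(S)) − γM)`, `M ≡ 0` and `S ≡ 1`
on `[0,∞)`, and `M → 0`, `S → s₋∞` as `ξ → −∞`. -/
def IsTW (lam gam v sInf : ℝ) (f F D M S : ℝ → ℝ) : Prop :=
  (∀ ξ, M ξ ∈ Set.Ico (0:ℝ) 1) ∧ (∀ ξ, S ξ ∈ Set.Ioc (0:ℝ) 1) ∧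
  Continuous M ∧
  (∀ ξ, HasDerivAt S (gam / v * (f (S ξ) * M ξ)) ξ) ∧
  (∀ ξ, 0 < M ξ → ∃ M' : ℝ, HasDerivAt M M' ξ ∧
    D (M ξ) * M' = v / gam * ((1 - S ξ - lam * F (S ξ)) - gam * M ξ)) ∧
  (∀ ξ, 0 ≤ ξ → M ξ = 0 ∧ S ξ = 1) ∧
  Filter.Tendsto M Filter.atBot (nhds 0) ∧
  Filter.Tendsto S Filter.atBot (nhds sInf)

theorem flux_and_particle_speed_at_front
    (lam gam kap : ℝ)
    (hlam : lam ∈ Set.Ioo (0:ℝ) 1) (hgam : gam ∈ Set.Ioo (0:ℝ) 1)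
    (hkap : kap ∈ Set.Ioc (0:ℝ) 1)
    (f f' F : ℝ → ℝ)
    (hf_maps : ∀ x ∈ Set.Icc (0:ℝ) 1, f x ∈ Set.Icc (0:ℝ) 1)
    (hf_mono : StrictMonoOn f (Set.Icc (0:ℝ) 1))
    (hf_deriv : ∀ x ∈ Set.Icc (0:ℝ) 1, HasDerivWithinAt f (f' x) (Set.Icc (0:ℝ) 1) x)
    (hf'_cont : ContinuousOn f' (Set.Icc (0:ℝ) 1))
    (hf_zero : f 0 = 0) (hf'_zero : f' 0 = 1 / kap)
    (hf_one : f 1 ∈ Set.Ioc lam 1)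
    (hF : ∀ s ∈ Set.Ioc (0:ℝ) 1, F s = ∫ ρ in s..1, 1 / f ρ)
    (D : ℝ → ℝ) (a b : ℝ) (ha : 1 < a) (hb : 1 < b)
    (hD_mono : MonotoneOn D (Set.Ico (0:ℝ) 1))
    (hD_nonneg : ∀ m ∈ Set.Ico (0:ℝ) 1, 0 ≤ D m)
    (hD_smooth : ∃ D' : ℝ → ℝ, ContinuousOn D' (Set.Ico (0:ℝ) 1) ∧
      ∀ m ∈ Set.Ico (0:ℝ) 1, HasDerivWithinAt D (D' m) (Set.Ico (0:ℝ) 1) m)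
    (LD0 LD1 : ℝ) (hLD0 : 0 < LD0) (hLD1 : 0 < LD1)
    (hD_zero : Filter.Tendsto (fun m => D m / m ^ a) (nhdsWithin 0 (Set.Ioi 0)) (nhds LD0))
    (hD_one : Filter.Tendsto (fun m => (1 - m) ^ b * D m) (nhdsWithin 1 (Set.Iio 1)) (nhds LD1))
    (ell : ℝ → ℝ)
    (hell : ∀ s ∈ Set.Ioc (0:ℝ) 1, ell s = 1 / gam * ((1 - s) - lam * F s))
    (sInf : ℝ) (hsInf_mem : sInf ∈ Set.Ioo (0:ℝ) 1)
    (hsInf_eq : sInf + lam * F sInf = 1)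
    (hsInf_uniq : ∀ s ∈ Set.Ioo (0:ℝ) 1, s + lam * F s = 1 → s = sInf)
    (v : ℝ) (hv : 0 < v) (M S : ℝ → ℝ)
    (hTW : IsTW lam gam v sInf f F D M S)
    (δ : ℝ) (hδ : 0 < δ) (hMpos : ∀ ξ ∈ Set.Ioo (-δ) (0:ℝ), 0 < M ξ) :
    Filter.Tendsto (fun ξ => D (M ξ) * deriv M ξ) (nhdsWithin 0 (Set.Iio 0)) (nhds 0) ∧
    Filter.Tendsto (fun ξ => -(D (M ξ) / M ξ) * deriv M ξ)
      (nhdsWithin 0 (Set.Iio 0)) (nhds v) ∧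
    Filter.Tendsto (fun ξ => ell (S ξ) / M ξ) (nhdsWithin 0 (Set.Iio 0)) (nhds 0) := by
  obtain ⟨hM, hS, hMc, hSd, hMd, h0, -, -⟩ := hTW
  obtain ⟨hl0, hl1⟩ := hlam
  obtain ⟨hg0, hg1⟩ := hgam
  have hfhalf : 0 < f (1/2) := by
    have := hf_mono (a := 0) (b := 1/2) (by norm_num) (by norm_num) (by norm_num)
    rwa [hf_zero] at this
  have hFnn : ∀ s ∈ Set.Ioc (0:ℝ) 1, 0 ≤ F s := by
    intro s hs
    rw [hF s hs]
    apply intervalIntegral.integral_nonneg hs.2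
    intro x hx
    exact one_div_nonneg.2 (hf_maps x ⟨hs.1.le.trans hx.1, hx.2⟩).1
  have hFle : ∀ s ∈ Set.Icc (1/2:ℝ) 1, F s ≤ 1 / f (1/2) * (1 - s) := by
    intro s hs
    have hs' : s ∈ Set.Ioc (0:ℝ) 1 := ⟨by linarith [hs.1], hs.2⟩
    rw [hF s hs']
    have := intervalIntegral.norm_integral_le_of_norm_le_const (a := s) (b := 1)
      (f := fun ρ => 1 / f ρ) (C := 1 / f (1/2)) (by
        intro x hx
        rw [Set.uIoc_of_le hs.2] at hx
        have hx1 : f (1/2) ≤ f x := hf_mono.monotoneOn (by norm_num)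
          ⟨by linarith [hx.1, hs.1], hx.2⟩ (by linarith [hx.1, hs.1])
        rw [Real.norm_of_nonneg (one_div_nonneg.2 (hfhalf.le.trans hx1))]
        exact one_div_le_one_div_of_le hfhalf hx1)
    rw [abs_of_nonneg (by linarith [hs.2])] at this
    exact (le_abs_self _).trans this
  -- the limits at the front
  have hM0 : Filter.Tendsto M (nhdsWithin 0 (Set.Iio 0)) (nhds 0) := by
    have := hMc.tendsto 0
    rw [(h0 0 le_rfl).1] at this
    exact this.mono_left nhdsWithin_le_nhds
  have hS0 : Filter.Tendsto S (nhdsWithin 0 (Set.Iio 0)) (nhds 1) := by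
    have := (hSd 0).continuousAt.tendsto
    rw [(h0 0 le_rfl).2] at this
    exact this.mono_left nhdsWithin_le_nhds
  have hposE : ∀ᶠ ξ in nhdsWithin (0:ℝ) (Set.Iio 0), 0 < M ξ := by
    filter_upwards [Ioo_mem_nhdsLT (show -δ < 0 by linarith)] with ξ hξ using hMpos ξ hξ
  have hM0' : Filter.Tendsto M (nhdsWithin 0 (Set.Iio 0)) (nhdsWithin 0 (Set.Ioi 0)) :=
    tendsto_nhdsWithin_iff.2 ⟨hM0, hposE⟩
  have hD0 : Filter.Tendsto D (nhdsWithin 0 (Set.Ioi 0)) (nhds 0) := by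
    have h1 : Filter.Tendsto (fun m : ℝ => m ^ a) (nhdsWithin 0 (Set.Ioi 0)) (nhds 0) := by
      have := (Real.continuousAt_rpow_const 0 a (Or.inr (by linarith))).tendsto
      rw [Real.zero_rpow (by linarith)] at this
      exact this.mono_left nhdsWithin_le_nhds
    have h2 := hD_zero.mul h1
    rw [mul_zero] at h2
    refine h2.congr' ?_
    filter_upwards [self_mem_nhdsWithin] with m hm
    exact div_mul_cancel₀ _ (Real.rpow_pos_of_pos hm a).ne'
  have hDpos : ∀ᶠ m in nhdsWithin (0:ℝ) (Set.Ioi 0), 0 < D m := by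
    filter_upwards [self_mem_nhdsWithin, hD_zero.eventually (lt_mem_nhds hLD0)] with m hm h
    have := mul_pos h (Real.rpow_pos_of_pos hm a)
    rwa [div_mul_cancel₀ _ (Real.rpow_pos_of_pos hm a).ne'] at this
  -- key estimate
  have key : ∀ ε : ℝ, 0 < ε → ε ≤ gam / 2 →
      ∀ᶠ ξ in nhdsWithin (0:ℝ) (Set.Iio 0), 1 - S ξ < ε * M ξ := by
    intro ε he heg
    have hc : 0 < ε * v ^ 2 / (2 * gam) := by positivity
    have hev := (hposE.and ((hM0'.eventually hDpos).and
      (hM0'.eventually (hD0.eventually (gt_mem_nhds hc)))))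
    obtain ⟨η, hη, hsub⟩ := (mem_nhdsLT_iff_exists_Ioo_subset).1 hev
    filter_upwards [Ioo_mem_nhdsLT hη] with x0 hx0
    by_contra hcon
    push Not at hcon
    -- derivative of M, totalised
    have hMder : ∀ x ∈ Set.Ioo η 0, HasDerivAt M (deriv M x) x ∧
        D (M x) * deriv M x = v / gam * ((1 - S x - lam * F (S x)) - gam * M x) := by
      intro x hx
      obtain ⟨m, hm, hm2⟩ := hMd x (hsub hx).1
      rw [hm.deriv]; exact ⟨hm, hm2⟩
    have hfS : ∀ x, f (S x) ≤ 1 := fun x => (hf_maps _ ⟨(hS x).1.le, (hS x).2⟩).2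
    have barrier : ∀ y ∈ Set.Ico x0 0, ε * M y ≤ 1 - S y := by
      intro y hy
      have hIoo : ∀ x ∈ Set.Icc x0 y, x ∈ Set.Ioo η 0 := fun x hx =>
        ⟨lt_of_lt_of_le hx0.1 hx.1, lt_of_le_of_lt hx.2 hy.2⟩
      have hd : ∀ x ∈ Set.Icc x0 y, HasDerivAt (fun x => ε * M x - (1 - S x))
          (ε * deriv M x - (0 - gam / v * (f (S x) * M x))) x := fun x hx =>
        ((hMder x (hIoo x hx)).1.const_mul ε).sub ((hasDerivAt_const x (1:ℝ)).sub (hSd x))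
      have := image_le_of_deriv_right_lt_deriv_boundary' (a := x0) (b := y)
        (f := fun x => ε * M x - (1 - S x))
        (f' := fun x => ε * deriv M x - (0 - gam / v * (f (S x) * M x)))
        (B := fun _ => (0:ℝ)) (B' := fun _ => (0:ℝ))
        (fun x hx => (hd x hx).continuousAt.continuousWithinAt)
        (fun x hx => (hd x ⟨hx.1, hx.2.le⟩).hasDerivWithinAt)
        (by simpa using hcon) continuousOn_const
        (fun x _ => hasDerivWithinAt_const _ _ _)
        (by
          intro x hx heq
          have hxI := hIoo x ⟨hx.1, hx.2.le⟩
          obtain ⟨hMp, hDp, hDl⟩ := hsub hxI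
          obtain ⟨-, hode⟩ := hMder x hxI
          have heq : ε * M x - (1 - S x) = 0 := heq
          change ε * deriv M x - (0 - gam / v * (f (S x) * M x)) < 0
          have hFn := hFnn _ (hS x)
          have hlF := mul_nonneg hl0.le hFn
          have h1 : D (M x) * deriv M x ≤ - (v / 2 * M x) := by
            rw [hode]
            have : (1 - S x - lam * F (S x)) - gam * M x ≤ - (gam / 2 * M x) := by
              nlinarith
            calc _ ≤ v / gam * (- (gam / 2 * M x)) :=
                  mul_le_mul_of_nonneg_left this (by positivity)
              _ = _ := by field_simp
          have h2 : gam / v * (f (S x) * M x) ≤ gam / v * M x := by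
            apply mul_le_mul_of_nonneg_left _ (by positivity)
            nlinarith [hfS x]
          have h3 : D (M x) * (gam / v) < ε * v / 2 := by
            rw [lt_div_iff₀ (by positivity)] at hDl
            rw [mul_div_assoc', div_lt_iff₀ hv]
            nlinarith
          have h4 : D (M x) * (ε * deriv M x + gam / v * M x) < 0 := by
            nlinarith
          have h5 := neg_of_mul_neg_right h4 hDp.le
          linarith)
        (Set.right_mem_Icc.2 hy.1)
      simpa using this
    -- Gronwall
    have hK : 0 < gam / v / ε := by positivity
    set K := gam / v / ε with hKdef
    have hgd : ∀ x, HasDerivAt (fun x => (1 - S x) * Real.exp (K * x))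
        ((0 - gam / v * (f (S x) * M x)) * Real.exp (K * x)
          + (1 - S x) * (Real.exp (K * x) * (K * 1))) x := fun x =>
      ((hasDerivAt_const x (1:ℝ)).sub (hSd x)).mul (((hasDerivAt_id x).const_mul K).exp)
    have hmono : MonotoneOn (fun x => (1 - S x) * Real.exp (K * x)) (Set.Icc x0 0) := by
      apply monotoneOn_of_deriv_nonneg (convex_Icc _ _)
      · exact fun x _ => (hgd x).continuousAt.continuousWithinAt
      · exact fun x _ => (hgd x).differentiableAt.differentiableWithinAt
      · intro x hx
        rw [interior_Icc] at hx
        rw [(hgd x).deriv]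
        have hb := barrier x ⟨hx.1.le, hx.2⟩
        have h2 : gam / v * (f (S x) * M x) ≤ gam / v * M x := by
          apply mul_le_mul_of_nonneg_left _ (by positivity)
          nlinarith [hfS x, (hM x).1]
        have h3 : gam / v * M x ≤ K * (1 - S x) := by
          calc gam / v * M x = K * (ε * M x) := by rw [hKdef]; field_simp
            _ ≤ _ := mul_le_mul_of_nonneg_left hb hK.le
        have : 0 ≤ (K * (1 - S x) - gam / v * (f (S x) * M x)) * Real.exp (K * x) :=
          mul_nonneg (by linarith) (Real.exp_pos _).le
        linarith
    have hfin := hmono (Set.left_mem_Icc.2 hx0.2.le) (Set.right_mem_Icc.2 hx0.2.le) hx0.2.le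
    simp only [(h0 0 le_rfl).2, sub_self, zero_mul] at hfin
    have hMp := (hsub hx0).1
    have : 0 < (1 - S x0) * Real.exp (K * x0) :=
      mul_pos (lt_of_lt_of_le (mul_pos he hMp) hcon) (Real.exp_pos _)
    linarith
  have hu : Filter.Tendsto (fun ξ => (1 - S ξ) / M ξ) (nhdsWithin 0 (Set.Iio 0)) (nhds 0) := by
    rw [Metric.tendsto_nhds]
    intro ε he
    filter_upwards [key (min ε (gam / 2)) (lt_min he (by linarith)) (min_le_right _ _),
      hposE] with ξ h1 h2
    rw [Real.dist_eq, sub_zero, abs_of_nonneg (div_nonneg (by linarith [(hS ξ).2]) h2.le),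
      div_lt_iff₀ h2]
    exact h1.trans_le (mul_le_mul_of_nonneg_right (min_le_left _ _) h2.le)
  have hq : Filter.Tendsto (fun ξ => ell (S ξ) / M ξ) (nhdsWithin 0 (Set.Iio 0)) (nhds 0) := by
    have hb := hu.const_mul (1 / gam * (1 + lam * (1 / f (1/2))))
    rw [mul_zero] at hb
    refine squeeze_zero_norm' ?_ hb
    filter_upwards [hposE, hS0.eventually (lt_mem_nhds (show (1/2:ℝ) < 1 by norm_num))]
      with ξ h1 h2
    rw [norm_div, Real.norm_of_nonneg h1.le, mul_div_assoc']
    apply div_le_div_of_nonneg_right _ h1.le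
    rw [hell _ (hS ξ), norm_mul, Real.norm_of_nonneg (show 0 ≤ 1 / gam by positivity), mul_assoc]
    apply mul_le_mul_of_nonneg_left _ (by positivity)
    have hFn := mul_nonneg hl0.le (hFnn _ (hS ξ))
    have hFl := mul_le_mul_of_nonneg_left (hFle _ ⟨h2.le, (hS ξ).2⟩) hl0.le
    have hs1 := (hS ξ).2
    rw [Real.norm_eq_abs, abs_le]
    constructor <;> nlinarith
  have hspeed : Filter.Tendsto (fun ξ => -(D (M ξ) / M ξ) * deriv M ξ)
      (nhdsWithin 0 (Set.Iio 0)) (nhds v) := by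
    have h1 := (hq.const_sub 1).const_mul v
    rw [sub_zero, mul_one] at h1
    refine h1.congr' ?_
    filter_upwards [hposE] with ξ hp
    obtain ⟨m, hm, hm2⟩ := hMd ξ hp
    rw [hm.deriv, hell _ (hS ξ)]
    have : -(D (M ξ) / M ξ) * m = -(D (M ξ) * m) / M ξ := by ring
    rw [this, hm2]
    field_simp
    ring
  refine ⟨?_, hspeed, hq⟩
  have h1 := (hspeed.mul hM0).neg
  rw [mul_zero, neg_zero] at h1
  refine h1.congr' ?_
  filter_upwards [hposE] with ξ hp
  field_simp
end

section
/- Fix v > 0. There is at most one continuous function 𝔐 : [s₋∞,1] → [0,1) such that: 𝔐(1) = 0; 𝔐 is positive exactly on an interval (σ,1) (and zero on [s₋∞,σ]); Φ(𝔐(s)) = (v²/γ) ∫_s^1 (𝔐(ρ) − ℓ(ρ)) dρ/f(ρ) for all s ∈ (σ,1); and ∫_s^1 dρ/(f(ρ)𝔐(ρ)) < ∞ for some s ∈ (σ,1). In particular, the orbit of the travelling-wave system connecting to the equilibrium (0,1) at a finite ξ-coordinate is unique, and it is the one whose M-map is the pointwise ε → 0 limit of the ε-M-maps. -/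
open Set MeasureTheory Filter Topology

lemma primL {p q : ℝ} {g : ℝ → ℝ} (hi : IntervalIntegrable g volume p q) (hpq : p ≤ q)
    (hc : ContinuousOn g (Ioo p q)) :
    (∀ x ∈ Ioo p q, HasDerivAt (fun u => ∫ t in u..q, g t) (-g x) x) ∧
    ContinuousOn (fun u => ∫ t in u..q, g t) (Icc p q) := by
  constructor
  · intro x hx
    apply intervalIntegral.integral_hasDerivAt_left
    · apply hi.mono_set
      rw [uIcc_of_le hx.2.le, uIcc_of_le hpq]
      exact Icc_subset_Icc_left hx.1.le
    · exact hc.stronglyMeasurableAtFilter isOpen_Ioo x hx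
    · exact hc.continuousAt (isOpen_Ioo.mem_nhds hx)
  · have h := intervalIntegral.continuousOn_primitive_interval_left (f := g) (a := p) (b := q)
      (μ := volume) (by rw [uIcc_of_le hpq]; exact (intervalIntegrable_iff_integrableOn_Icc_of_le hpq).1 hi)
    rwa [uIcc_of_le hpq] at h

lemma primR {g : ℝ → ℝ} (hc : ContinuousOn g (Ico (0:ℝ) 1)) :
    (∀ x ∈ Ioo (0:ℝ) 1, HasDerivAt (fun u => ∫ t in (0:ℝ)..u, g t) (g x) x) ∧
    ContinuousOn (fun u => ∫ t in (0:ℝ)..u, g t) (Ico 0 1) := by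
  constructor
  · intro x hx
    apply intervalIntegral.integral_hasDerivAt_right
    · apply ContinuousOn.intervalIntegrable
      rw [uIcc_of_le hx.1.le]
      exact hc.mono (fun t ht => ⟨ht.1, ht.2.trans_lt hx.2⟩)
    · exact (hc.mono Ioo_subset_Ico_self).stronglyMeasurableAtFilter isOpen_Ioo x hx
    · exact (hc.mono Ioo_subset_Ico_self).continuousAt (isOpen_Ioo.mem_nhds hx)
  · intro x hx
    obtain ⟨y, hxy, hy⟩ := exists_between hx.2
    have hy0 : (0:ℝ) ≤ y := hx.1.trans hxy.le
    have h := intervalIntegral.continuousOn_primitive_interval (f := g) (a := 0) (b := y)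
      (μ := volume) (by
        rw [uIcc_of_le hy0]
        exact (hc.mono (fun t ht => ⟨ht.1, ht.2.trans_lt hy⟩)).integrableOn_Icc)
    rw [uIcc_of_le hy0] at h
    have h2 := h x ⟨hx.1, hxy.le⟩
    apply h2.mono_of_mem_nhdsWithin
    rw [mem_nhdsWithin]
    exact ⟨Iio y, isOpen_Iio, hxy, fun t ht => ⟨ht.2.1, ht.1.le⟩⟩

lemma deriv_of_comp {P M : ℝ → ℝ} {s P' w' : ℝ} (hM : ContinuousAt M s)
    (hP : HasDerivAt P P' (M s)) (hP' : P' ≠ 0)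
    (hw : HasDerivAt (fun t => P (M t)) w' s) : HasDerivAt M (w' / P') s := by
  rw [hasDerivAt_iff_tendsto_slope]
  have hq : ContinuousAt (dslope P (M s)) (M s) :=
    continuousAt_dslope_same.2 hP.differentiableAt
  have hq2 : Tendsto (fun t => dslope P (M s) (M t)) (𝓝[≠] s) (𝓝 P') := by
    have h1 : ContinuousAt (fun t => dslope P (M s) (M t)) s := ContinuousAt.comp (f := M) hq hM
    have h2 : dslope P (M s) (M s) = P' := by rw [dslope_same, hP.deriv]
    have h3 := h1.tendsto
    simp only [h2] at h3
    exact h3.mono_left nhdsWithin_le_nhds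
  have hw2 := (hasDerivAt_iff_tendsto_slope.1 hw).div hq2 hP'
  refine hw2.congr' ?_
  filter_upwards [hq2.eventually_ne hP', self_mem_nhdsWithin] with t ht hts
  have h := sub_smul_dslope P (M s) (M t)
  simp only [smul_eq_mul] at h
  simp only [Pi.div_apply, slope_def_field]
  rw [← h]
  field_simp

section core
variable {f ell D M : ℝ → ℝ} {p σ c L : ℝ}

/-- one-solution facts -/
lemma one_sol (hc : 0 < c) (hL : 0 < L) (hpσ : p ≤ σ)
    (hf : ContinuousOn f (Icc p 1)) (hf0 : ∀ x ∈ Icc p 1, 0 < f x ∧ f x ≤ 1)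
    (hell : ContinuousOn ell (Icc p 1)) (hellL : ∀ x ∈ Icc p 1, |ell x| ≤ L * (1 - x))
    (hD : ContinuousOn D (Ico 0 1)) (hDm : MonotoneOn D (Ico 0 1))
    (hDp : ∀ m ∈ Ioo (0:ℝ) 1, 0 < D m)
    (hM : ContinuousOn M (Icc p 1)) (hM1 : M 1 = 0)
    (hMp : ∀ s ∈ Ioo σ 1, 0 < M s ∧ M s < 1)
    (hODE : ∀ s ∈ Ioo σ 1, ∫ ρ in (0:ℝ)..(M s), ρ * D ρ = c * ∫ ρ in s..1, (M ρ - ell ρ) / f ρ)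
    (hint : ∃ s ∈ Ioo σ 1, IntervalIntegrable (fun ρ => 1 / (f ρ * M ρ)) volume s 1)
    (s0 : ℝ) (hs0 : s0 ∈ Ioo σ 1) :
    IntervalIntegrable (fun ρ => 1 / (f ρ * M ρ)) volume s0 1 ∧
    ContinuousOn (fun ρ => 1 / (f ρ * M ρ)) (Ioo σ 1) ∧
    ContinuousOn (fun s => ∫ t in (0:ℝ)..(M s), D t) (Icc s0 1) ∧
    (∀ s ∈ Ioo σ 1, HasDerivAt (fun s => ∫ t in (0:ℝ)..(M s), D t)
      (c / f s * (ell s / M s - 1)) s) ∧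
    ∃ C > 0, ∀ s ∈ Ico s0 1, 1 - s ≤ C * (M s * D (M s)) := by
  have hsub : Ioo σ 1 ⊆ Icc p 1 := fun x hx => ⟨hpσ.trans hx.1.le, hx.2.le⟩
  have hcont : ContinuousOn (fun ρ => 1 / (f ρ * M ρ)) (Ioo σ 1) := by
    apply continuousOn_const.div ((hf.mono hsub).mul (hM.mono hsub))
    intro x hx
    exact (mul_pos (hf0 x (hsub hx)).1 (hMp x hx).1).ne'
  have hint0 : ∀ s0 ∈ Ioo σ 1, IntervalIntegrable (fun ρ => 1 / (f ρ * M ρ)) volume s0 1 := by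
    intro s0 hs0
    obtain ⟨s, hs, hi⟩ := hint
    refine IntervalIntegrable.trans (b := s) ?_ hi
    apply ContinuousOn.intervalIntegrable
    apply hcont.mono
    intro x hx
    rw [mem_uIcc] at hx
    rcases hx with hx | hx
    · exact ⟨hs0.1.trans_le hx.1, hx.2.trans_lt hs.2⟩
    · exact ⟨hs.1.trans_le hx.1, hx.2.trans_lt hs0.2⟩
  have hEc := primR hD
  have hMI : ∀ s ∈ Ioc σ 1, M s ∈ Ico (0:ℝ) 1 := by
    intro s hs
    rcases hs.2.lt_or_eq with h | h
    · exact ⟨(hMp s ⟨hs.1, h⟩).1.le, (hMp s ⟨hs.1, h⟩).2⟩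
    · rw [h, hM1]; simp
  have hEM : ∀ s0 ∈ Ioo σ 1, ContinuousOn (fun s => ∫ t in (0:ℝ)..(M s), D t) (Icc s0 1) := by
    intro s0 hs0
    apply hEc.2.comp (hM.mono (Icc_subset_Icc_left (hpσ.trans hs0.1.le)))
    intro x hx
    exact hMI x ⟨hs0.1.trans_le hx.1, hx.2⟩
  have hder : ∀ s ∈ Ioo σ 1, HasDerivAt (fun s => ∫ t in (0:ℝ)..(M s), D t)
      (c / f s * (ell s / M s - 1)) s := by
    intro s hs
    have hms := hMp s hs
    have hp1 : p ≤ 1 := hpσ.trans (hs.1.trans hs.2).le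
    have hgc : ContinuousOn (fun ρ => (M ρ - ell ρ) / f ρ) (Icc p 1) :=
      (hM.sub hell).div hf (fun x hx => (hf0 x hx).1.ne')
    have hw := (primL (hgc.intervalIntegrable_of_Icc hp1) hp1 (hgc.mono Ioo_subset_Icc_self)).1 s
      ⟨hpσ.trans_lt hs.1, hs.2⟩
    have hw2 : HasDerivAt (fun s => ∫ ρ in (0:ℝ)..(M s), ρ * D ρ) (c * -((M s - ell s) / f s)) s := by
      apply (hw.const_mul c).congr_of_eventuallyEq
      filter_upwards [isOpen_Ioo.mem_nhds hs] with t ht using hODE t ht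
    have hP := (primR (g := fun ρ => ρ * D ρ) (continuousOn_id.mul hD)).1 (M s) hms
    have hMc : ContinuousAt M s := (hM.mono hsub).continuousAt (isOpen_Ioo.mem_nhds hs)
    have hDM := hDp _ hms
    have hMd := deriv_of_comp (P := fun u => ∫ t in (0:ℝ)..u, t * D t) hMc hP
      (mul_pos hms.1 hDM).ne' hw2
    have := HasDerivAt.comp s (hEc.1 (M s) hms) hMd
    have hfs := (hf0 s (hsub hs)).1.ne'
    have hms0 := hms.1.ne'
    have hDM0 := hDM.ne'
    have e : c / f s * (ell s / M s - 1) =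
        D (M s) * (c * -((M s - ell s) / f s) / (M s * D (M s))) := by
      field_simp
      ring
    rw [e]
    exact this
  refine ⟨hint0 s0 hs0, hcont, hEM s0 hs0, hder, ?_⟩
  -- J
  have hJ := primL (hint0 s0 hs0) hs0.2.le (hcont.mono (Ioo_subset_Ioo_left hs0.1.le))
  have hkey : ∀ s ∈ Ioo σ 1, c * (1 - s) * (1 - L * ∫ t in s..1, 1 / (f t * M t)) ≤
      ∫ t in (0:ℝ)..(M s), D t := by
    intro s hs
    have hJ := primL (hint0 s hs) hs.2.le (hcont.mono (Ioo_subset_Ioo_left hs.1.le))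
    have hanti : AntitoneOn (fun t => (∫ u in (0:ℝ)..(M t), D u) +
        c * L * (1 - s) * (∫ u in t..1, 1 / (f u * M u)) + c * t) (Icc s 1) := by
      apply antitoneOn_of_hasDerivWithinAt_nonpos (convex_Icc s 1)
        (f' := fun t => c / f t * (ell t / M t - 1) + c * L * (1 - s) * (-(1 / (f t * M t))) + c * 1)
      · exact ((hEM s hs).add (continuousOn_const.mul hJ.2)).add (continuousOn_const.mul continuousOn_id)
      · intro t ht
        rw [interior_Icc] at ht
        exact (((hder t ⟨hs.1.trans ht.1, ht.2⟩).add ((hJ.1 t ht).const_mul _)).add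
          ((hasDerivAt_id t).const_mul c)).hasDerivWithinAt
      · intro t ht
        rw [interior_Icc] at ht
        have htσ : t ∈ Ioo σ 1 := ⟨hs.1.trans ht.1, ht.2⟩
        have h1 := hf0 t (hsub htσ)
        have h2 := hMp t htσ
        have h3 := (le_abs_self _).trans (hellL t (hsub htσ))
        have hmf : 0 < f t * M t := mul_pos h1.1 h2.1
        have e : c / f t * (ell t / M t - 1) + c * L * (1 - s) * (-(1 / (f t * M t))) + c * 1
          = -(c * (L * (1 - s) - ell t + (1 - f t) * M t) / (f t * M t)) := by
          have := h1.1.ne'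
          have := h2.1.ne'
          field_simp
          ring
        rw [e, neg_nonpos]
        apply div_nonneg _ hmf.le
        apply mul_nonneg hc.le
        have : L * (1 - t) ≤ L * (1 - s) := by
          apply mul_le_mul_of_nonneg_left _ hL.le
          linarith [ht.1]
        have := mul_nonneg (sub_nonneg.2 h1.2) h2.1.le
        linarith
    have h := hanti (left_mem_Icc.2 hs.2.le) (right_mem_Icc.2 hs.2.le) hs.2.le
    simp only [hM1, intervalIntegral.integral_same] at h
    linarith
  have hED : ∀ s ∈ Ioo σ 1, ∫ t in (0:ℝ)..(M s), D t ≤ M s * D (M s) := by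
    intro s hs
    have hms := hMp s hs
    have hi : IntervalIntegrable D volume 0 (M s) :=
      (hD.mono (fun t ht => ⟨ht.1, ht.2.trans_lt hms.2⟩)).intervalIntegrable_of_Icc hms.1.le
    have := intervalIntegral.integral_mono_on hms.1.le hi
      (intervalIntegrable_const (c := D (M s))) (fun x hx =>
        hDm ⟨hx.1, hx.2.trans_lt hms.2⟩ ⟨hms.1.le, hms.2⟩ hx.2)
    simpa using this
  -- near 1
  have hJ1 : Tendsto (fun s => L * ∫ t in s..1, 1 / (f t * M t)) (𝓝[Icc s0 1] 1) (𝓝 0) := by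
    have := ((hJ.2 1 (right_mem_Icc.2 hs0.2.le)).tendsto).const_mul L
    simpa using this
  have hev := hJ1.eventually (gt_mem_nhds (show (0:ℝ) < 1/2 by norm_num))
  obtain ⟨U, hU, hU1, hUs⟩ := mem_nhdsWithin.1 hev
  obtain ⟨l, hl, hlU⟩ := exists_Ioc_subset_of_mem_nhds (hU.mem_nhds hU1) ⟨s0, hs0.2⟩
  obtain ⟨s1, hs1, hs11⟩ := exists_between (max_lt hl hs0.2)
  have hs01 : s0 < s1 := (le_max_right _ _).trans_lt hs1
  have hls1 : l < s1 := (le_max_left _ _).trans_lt hs1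
  have hnear : ∀ s ∈ Ico s1 1, 1 - s ≤ 2 / c * (M s * D (M s)) := by
    intro s hs
    have hs' : s ∈ Ioo σ 1 := ⟨hs0.1.trans (hs01.trans_le hs.1), hs.2⟩
    have h1 := hUs ⟨hlU ⟨hls1.trans_le hs.1, hs.2.le⟩, ⟨(hs01.trans_le hs.1).le, hs.2.le⟩⟩
    simp only [mem_setOf_eq] at h1
    have h2 := hkey s hs'
    have h3 := hED s hs'
    have h4 : c * (1 - s) * (1/2) ≤ M s * D (M s) := by
      refine le_trans ?_ (h2.trans h3)
      apply mul_le_mul_of_nonneg_left (by linarith)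
      exact mul_nonneg hc.le (by linarith [hs.2])
    rw [div_mul_eq_mul_div, le_div_iff₀ hc]
    linarith
  have hMDc : ContinuousOn (fun s => M s * D (M s)) (Icc s0 s1) := by
    have hs' : Icc s0 s1 ⊆ Icc p 1 := fun x hx => ⟨hpσ.trans (hs0.1.le.trans hx.1), hx.2.trans hs11.le⟩
    apply (hM.mono hs').mul
    apply hD.comp (hM.mono hs')
    intro x hx
    exact hMI x ⟨hs0.1.trans_le hx.1, hx.2.trans hs11.le⟩
  obtain ⟨x, hx, hxm⟩ := isCompact_Icc.exists_isMinOn (nonempty_Icc.2 hs01.le) hMDc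
  have hx' : x ∈ Ioo σ 1 := ⟨hs0.1.trans_le hx.1, hx.2.trans_lt hs11⟩
  have hδ : 0 < M x * D (M x) := mul_pos (hMp x hx').1 (hDp _ (hMp x hx'))
  set δ := M x * D (M x) with hδdef
  refine ⟨2 / c + (1 - s0) / δ, add_pos (by positivity) (div_pos (by linarith [hs0.2]) hδ), ?_⟩
  intro s hs
  have hsσ : s ∈ Ioo σ 1 := ⟨hs0.1.trans_le hs.1, hs.2⟩
  have hpos : 0 < M s * D (M s) := mul_pos (hMp s hsσ).1 (hDp _ (hMp s hsσ))
  have hA : 0 ≤ 2 / c * (M s * D (M s)) := by positivity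
  have hB : 0 ≤ (1 - s0) / δ * (M s * D (M s)) :=
    mul_nonneg (div_nonneg (by linarith [hs0.2]) hδ.le) hpos.le
  rw [add_mul]
  rcases le_total s s1 with h | h
  · have hm : δ ≤ M s * D (M s) := hxm ⟨hs.1, h⟩
    have : (1 - s0) / δ * δ ≤ (1 - s0) / δ * (M s * D (M s)) :=
      mul_le_mul_of_nonneg_left hm (div_nonneg (by linarith [hs0.2]) hδ.le)
    rw [div_mul_cancel₀ _ hδ.ne'] at this
    linarith [hs.1]
  · linarith [hnear s ⟨h, hs.2⟩]

lemma no_gt {M2 : ℝ → ℝ} {σ2 : ℝ} (hc : 0 < c) (hL : 0 < L) (hpσ : p ≤ σ) (hpσ2 : p ≤ σ2)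
    (hf : ContinuousOn f (Icc p 1)) (hf0 : ∀ x ∈ Icc p 1, 0 < f x ∧ f x ≤ 1)
    (hell : ContinuousOn ell (Icc p 1)) (hellL : ∀ x ∈ Icc p 1, |ell x| ≤ L * (1 - x))
    (hD : ContinuousOn D (Ico 0 1)) (hDm : MonotoneOn D (Ico 0 1))
    (hDp : ∀ m ∈ Ioo (0:ℝ) 1, 0 < D m)
    (hM : ContinuousOn M (Icc p 1)) (hM1 : M 1 = 0)
    (hMp : ∀ s ∈ Ioo σ 1, 0 < M s ∧ M s < 1)
    (hODE : ∀ s ∈ Ioo σ 1, ∫ ρ in (0:ℝ)..(M s), ρ * D ρ = c * ∫ ρ in s..1, (M ρ - ell ρ) / f ρ)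
    (hint : ∃ s ∈ Ioo σ 1, IntervalIntegrable (fun ρ => 1 / (f ρ * M ρ)) volume s 1)
    (hM' : ContinuousOn M2 (Icc p 1)) (hM1' : M2 1 = 0)
    (hMp' : ∀ s ∈ Ioo σ2 1, 0 < M2 s ∧ M2 s < 1)
    (hODE' : ∀ s ∈ Ioo σ2 1, ∫ ρ in (0:ℝ)..(M2 s), ρ * D ρ = c * ∫ ρ in s..1, (M2 ρ - ell ρ) / f ρ)
    (hint' : ∃ s ∈ Ioo σ2 1, IntervalIntegrable (fun ρ => 1 / (f ρ * M2 ρ)) volume s 1)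
    (s0 : ℝ) (hs0 : s0 ∈ Ioo σ 1) (hs0' : s0 ∈ Ioo σ2 1) : M s0 ≤ M2 s0 := by
  by_contra! hlt
  obtain ⟨hi, hic, hE, hEd, -⟩ := one_sol hc hL hpσ hf hf0 hell hellL hD hDm hDp hM hM1 hMp hODE hint s0 hs0
  obtain ⟨-, -, hE', hEd', C, hC, hCb⟩ :=
    one_sol hc hL hpσ2 hf hf0 hell hellL hD hDm hDp hM' hM1' hMp' hODE' hint' s0 hs0'
  have hsub : Icc s0 1 ⊆ Icc p 1 := Icc_subset_Icc_left (hpσ.trans hs0.1.le)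
  have hScl : IsClosed (Icc s0 1 ∩ (fun x => M x - M2 x) ⁻¹' Iic 0) :=
    ((hM.sub hM').mono hsub).preimage_isClosed_of_isClosed isClosed_Icc isClosed_Iic
  have hSc : IsCompact (Icc s0 1 ∩ (fun x => M x - M2 x) ⁻¹' Iic 0) :=
    isCompact_Icc.of_isClosed_subset hScl inter_subset_left
  obtain ⟨z, hz, hzl⟩ := hSc.exists_isLeast ⟨1, ⟨hs0.2.le, le_rfl⟩, by simp [hM1, hM1']⟩
  have hzM : M z ≤ M2 z := by have := hz.2; simp only [mem_preimage, mem_Iic] at this; linarith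
  have hs0z : s0 < z := by
    rcases hz.1.1.lt_or_eq with h | h
    · exact h
    · rw [← h] at hzM; linarith
  have hgt : ∀ t ∈ Ico s0 z, M2 t < M t := by
    intro t ht
    by_contra! h
    have := hzl (a := t) ⟨⟨ht.1, ht.2.le.trans hz.1.2⟩, by simp only [mem_preimage, mem_Iic]; linarith⟩
    linarith [ht.2]
  -- integrals of D
  have hDint : ∀ m ∈ Ico (0:ℝ) 1, IntervalIntegrable D volume 0 m := fun m hm =>
    (hD.mono (fun t ht => ⟨ht.1, ht.2.trans_lt hm.2⟩)).intervalIntegrable_of_Icc hm.1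
  have hlow : ∀ t ∈ Ico s0 z, D (M2 t) * (M t - M2 t) ≤
      (∫ u in (0:ℝ)..(M t), D u) - ∫ u in (0:ℝ)..(M2 t), D u := by
    intro t ht
    have ht1 : t < 1 := ht.2.trans_le hz.1.2
    have h1 := hMp t ⟨hs0.1.trans_le ht.1, ht1⟩
    have h2 := hMp' t ⟨hs0'.1.trans_le ht.1, ht1⟩
    have i1 := hDint _ ⟨h1.1.le, h1.2⟩
    have i2 := hDint _ ⟨h2.1.le, h2.2⟩
    rw [intervalIntegral.integral_interval_sub_left i1 i2]
    have := intervalIntegral.integral_mono_on (hgt t ht).le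
      (intervalIntegrable_const (c := D (M2 t))) (i2.symm.trans i1) (fun x hx =>
        hDm ⟨h2.1.le, h2.2⟩ ⟨h2.1.le.trans hx.1, hx.2.trans_lt h1.2⟩ hx.1)
    simp only [intervalIntegral.integral_const, smul_eq_mul] at this
    linarith
  have hK := primL hi hs0.2.le (hic.mono (Ioo_subset_Ioo_left hs0.1.le))
  set A := c * L * C with hA
  have hsubz : Icc s0 z ⊆ Icc s0 1 := Icc_subset_Icc_right hz.1.2
  have hmono : MonotoneOn (fun t => ((∫ u in (0:ℝ)..(M t), D u) - ∫ u in (0:ℝ)..(M2 t), D u) *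
      Real.exp (-(A * ∫ u in t..1, 1 / (f u * M u)))) (Icc s0 z) := by
    apply monotoneOn_of_hasDerivWithinAt_nonneg (convex_Icc s0 z)
      (f' := fun t => (c / f t * (ell t / M t - 1) - c / f t * (ell t / M2 t - 1)) *
        Real.exp (-(A * ∫ u in t..1, 1 / (f u * M u))) +
        ((∫ u in (0:ℝ)..(M t), D u) - ∫ u in (0:ℝ)..(M2 t), D u) *
        (Real.exp (-(A * ∫ u in t..1, 1 / (f u * M u))) * (-(A * -(1 / (f t * M t))))))
    · exact ((hE.sub hE').mul (Real.continuous_exp.comp_continuousOn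
        (continuousOn_const.mul hK.2).neg)).mono hsubz
    · intro t ht
      rw [interior_Icc] at ht
      have ht1 : t < 1 := ht.2.trans_le hz.1.2
      exact (((hEd t ⟨hs0.1.trans ht.1, ht1⟩).sub (hEd' t ⟨hs0'.1.trans ht.1, ht1⟩)).mul
        (((hK.1 t ⟨ht.1, ht1⟩).const_mul A).neg.exp)).hasDerivWithinAt
    · intro t ht
      rw [interior_Icc] at ht
      have ht1 : t < 1 := ht.2.trans_le hz.1.2
      have h1 := hMp t ⟨hs0.1.trans ht.1, ht1⟩
      have h2 := hMp' t ⟨hs0'.1.trans ht.1, ht1⟩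
      have hfp := (hf0 t (hsub ⟨ht.1.le, ht1.le⟩)).1
      have hl := (le_abs_self _).trans (hellL t (hsub ⟨ht.1.le, ht1.le⟩))
      have hb := hCb t ⟨ht.1.le, ht1⟩
      have hlo := hlow t ⟨ht.1.le, ht.2⟩
      have hg := hgt t ⟨ht.1.le, ht.2⟩
      set H := (∫ u in (0:ℝ)..(M t), D u) - ∫ u in (0:ℝ)..(M2 t), D u
      set X := Real.exp (-(A * ∫ u in t..1, 1 / (f u * M u)))
      have hX : 0 < X := Real.exp_pos _
      have e : (c / f t * (ell t / M t - 1) - c / f t * (ell t / M2 t - 1)) * X +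
        H * (X * (-(A * -(1 / (f t * M t))))) =
        X * c / (f t * M t * M2 t) * (L * C * M2 t * H - ell t * (M t - M2 t)) := by
        have := hfp.ne'
        have := h1.1.ne'
        have := h2.1.ne'
        rw [hA]
        field_simp
        ring
      rw [e]
      apply mul_nonneg
      · exact div_nonneg (by positivity) (mul_pos (mul_pos hfp h1.1) h2.1).le
      · have k1 : ell t * (M t - M2 t) ≤ L * (C * (M2 t * D (M2 t))) * (M t - M2 t) := by
          apply mul_le_mul_of_nonneg_right _ (by linarith)
          exact hl.trans (mul_le_mul_of_nonneg_left hb hL.le)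
        have k2 : L * C * M2 t * (D (M2 t) * (M t - M2 t)) ≤ L * C * M2 t * H :=
          mul_le_mul_of_nonneg_left hlo (mul_pos (mul_pos hL hC) h2.1).le
        nlinarith
  have hfin := hmono (left_mem_Icc.2 hs0z.le) (right_mem_Icc.2 hs0z.le) hs0z.le
  have hMz : M z = M2 z := by
    apply le_antisymm hzM
    have hcl : closure (Ico s0 z) = Icc s0 z := closure_Ico hs0z.ne
    have hz' : z ∈ closure (Ico s0 z) := by rw [hcl]; exact right_mem_Icc.2 hs0z.le
    refine ContinuousWithinAt.closure_le hz' (f := M2) (g := M) ?_ ?_ (fun y hy => (hgt y hy).le)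
    · exact (hM' z (hsub hz.1)).mono (fun y hy => hsub ⟨hy.1, hy.2.le.trans hz.1.2⟩)
    · exact (hM z (hsub hz.1)).mono (fun y hy => hsub ⟨hy.1, hy.2.le.trans hz.1.2⟩)
  simp only [hMz, sub_self, zero_mul] at hfin
  have hlo := hlow s0 ⟨le_rfl, hs0z⟩
  have hp0 : 0 < D (M2 s0) * (M s0 - M2 s0) := mul_pos (hDp _ (hMp' s0 hs0')) (by linarith)
  have := mul_pos (hp0.trans_le hlo) (Real.exp_pos (-(A * ∫ u in s0..1, 1 / (f u * M u))))
  linarith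

end core

/-- The M-map `𝔐_v`: continuous on `[s₋∞,1]`, zero at `1`, positive (and `< 1`)
exactly on `(σ,1)`, zero on `[s₋∞,σ]`, satisfying the integrated ODE
`Φ(𝔐_v(s)) = (v²/γ) ∫_s^1 (𝔐_v(ρ) − ℓ(ρ))/f(ρ) dρ` on `(σ,1)`, and such that
`∫_s^1 dρ/(f(ρ)𝔐_v(ρ)) < ∞` for some `s ∈ (σ,1)`. -/
def IsMMap (gam v sInf sigma : ℝ) (f ell Phi Mv : ℝ → ℝ) : Prop :=
  ContinuousOn Mv (Set.Icc sInf 1) ∧ Mv 1 = 0 ∧ sigma ∈ Set.Icc sInf 1 ∧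
  (∀ s ∈ Set.Ioo sigma 1, 0 < Mv s ∧ Mv s < 1) ∧
  (∀ s ∈ Set.Icc sInf sigma, Mv s = 0) ∧
  (∀ s ∈ Set.Ioo sigma 1,
    Phi (Mv s) = v ^ 2 / gam * ∫ ρ in s..1, (Mv ρ - ell ρ) / f ρ) ∧
  (∃ s ∈ Set.Ioo sigma 1,
    IntervalIntegrable (fun ρ => 1 / (f ρ * Mv ρ)) MeasureTheory.volume s 1)
theorem M_map_unique
    (lam gam kap : ℝ)
    (hlam : lam ∈ Set.Ioo (0:ℝ) 1) (hgam : gam ∈ Set.Ioo (0:ℝ) 1)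
    (hkap : kap ∈ Set.Ioc (0:ℝ) 1)
    (f f' F : ℝ → ℝ)
    (hf_maps : ∀ x ∈ Set.Icc (0:ℝ) 1, f x ∈ Set.Icc (0:ℝ) 1)
    (hf_mono : StrictMonoOn f (Set.Icc (0:ℝ) 1))
    (hf_deriv : ∀ x ∈ Set.Icc (0:ℝ) 1, HasDerivWithinAt f (f' x) (Set.Icc (0:ℝ) 1) x)
    (hf'_cont : ContinuousOn f' (Set.Icc (0:ℝ) 1))
    (hf_zero : f 0 = 0) (hf'_zero : f' 0 = 1 / kap)
    (hf_one : f 1 ∈ Set.Ioc lam 1)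
    (hF : ∀ s ∈ Set.Ioc (0:ℝ) 1, F s = ∫ ρ in s..1, 1 / f ρ)
    (D : ℝ → ℝ) (a b : ℝ) (ha : 1 < a) (hb : 1 < b)
    (hD_mono : MonotoneOn D (Set.Ico (0:ℝ) 1))
    (hD_nonneg : ∀ m ∈ Set.Ico (0:ℝ) 1, 0 ≤ D m)
    (hD_smooth : ∃ D' : ℝ → ℝ, ContinuousOn D' (Set.Ico (0:ℝ) 1) ∧
      ∀ m ∈ Set.Ico (0:ℝ) 1, HasDerivWithinAt D (D' m) (Set.Ico (0:ℝ) 1) m)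
    (LD0 LD1 : ℝ) (hLD0 : 0 < LD0) (hLD1 : 0 < LD1)
    (hD_zero : Filter.Tendsto (fun m => D m / m ^ a) (nhdsWithin 0 (Set.Ioi 0)) (nhds LD0))
    (hD_one : Filter.Tendsto (fun m => (1 - m) ^ b * D m) (nhdsWithin 1 (Set.Iio 1)) (nhds LD1))
    (ell : ℝ → ℝ)
    (hell : ∀ s ∈ Set.Ioc (0:ℝ) 1, ell s = 1 / gam * ((1 - s) - lam * F s))
    (sInf : ℝ) (hsInf_mem : sInf ∈ Set.Ioo (0:ℝ) 1)
    (hsInf_eq : sInf + lam * F sInf = 1)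
    (hsInf_uniq : ∀ s ∈ Set.Ioo (0:ℝ) 1, s + lam * F s = 1 → s = sInf)
    (sM : ℝ) (hsM_mem : sM ∈ Set.Ioo (0:ℝ) 1) (hsM_eq : f sM = lam)
    (hpar : sM + lam * F sM < 1 - gam)
    (Phi : ℝ → ℝ)
    (hPhi : ∀ m ∈ Set.Ico (0:ℝ) 1, Phi m = ∫ ρ in (0:ℝ)..m, ρ * D ρ)
    (v : ℝ) (hv : 0 < v) :
    ∀ (sigma1 sigma2 : ℝ) (M1 M2 : ℝ → ℝ),
      IsMMap gam v sInf sigma1 f ell Phi M1 →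
      IsMMap gam v sInf sigma2 f ell Phi M2 →
      ∀ s ∈ Set.Icc sInf 1, M1 s = M2 s := by
  intro sigma1 sigma2 M1 M2 h1 h2
  obtain ⟨hlam0, hlam1⟩ := hlam
  obtain ⟨hg0, hg1⟩ := hgam
  obtain ⟨hp0, hp1⟩ := hsInf_mem
  have hsub : Icc sInf 1 ⊆ Icc (0:ℝ) 1 := Icc_subset_Icc_left hp0.le
  have hfc : ContinuousOn f (Icc sInf 1) := fun x hx =>
    ((hf_deriv x (hsub hx)).continuousWithinAt).mono hsub
  have hfpp : 0 < f sInf := by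
    have := hf_mono (left_mem_Icc.2 zero_le_one) ⟨hp0.le, hp1.le⟩ hp0
    rwa [hf_zero] at this
  have hfge : ∀ x ∈ Icc sInf 1, f sInf ≤ f x := fun x hx =>
    hf_mono.monotoneOn ⟨hp0.le, hp1.le⟩ (hsub hx) hx.1
  have hf0 : ∀ x ∈ Icc sInf 1, 0 < f x ∧ f x ≤ 1 := fun x hx =>
    ⟨hfpp.trans_le (hfge x hx), (hf_maps x (hsub hx)).2⟩
  have hinvc : ContinuousOn (fun x => 1 / f x) (Icc sInf 1) :=
    continuousOn_const.div hfc (fun x hx => (hf0 x hx).1.ne')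
  have hell' : ∀ s ∈ Icc sInf 1, ell s = 1 / gam * ((1 - s) - lam * ∫ ρ in s..1, 1 / f ρ) := by
    intro s hs
    rw [hell s ⟨hp0.trans_le hs.1, hs.2⟩, hF s ⟨hp0.trans_le hs.1, hs.2⟩]
  have hellc : ContinuousOn ell (Icc sInf 1) := by
    have hJ := (primL (hinvc.intervalIntegrable_of_Icc hp1.le) hp1.le
      (hinvc.mono Ioo_subset_Icc_self)).2
    refine ContinuousOn.congr ?_ hell'
    exact continuousOn_const.mul ((continuousOn_const.sub continuousOn_id).sub (continuousOn_const.mul hJ))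
  set L := 1 / gam * (1 + lam / f sInf) with hLdef
  have hL : 0 < L := by positivity
  have hellL : ∀ x ∈ Icc sInf 1, |ell x| ≤ L * (1 - x) := by
    intro x hx
    have hx1 : 0 ≤ 1 - x := by linarith [hx.2]
    have hsx : Icc x 1 ⊆ Icc sInf 1 := Icc_subset_Icc_left hx.1
    have hix := (hinvc.mono hsx).intervalIntegrable_of_Icc hx.2 (μ := volume)
    have hi0 : 0 ≤ ∫ ρ in x..1, 1 / f ρ := intervalIntegral.integral_nonneg hx.2
      (fun u hu => (one_div_pos.2 (hf0 u (hsx hu)).1).le)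
    have hi1 : ∫ ρ in x..1, 1 / f ρ ≤ (1 - x) * (1 / f sInf) := by
      have := intervalIntegral.integral_mono_on hx.2 hix
        (intervalIntegrable_const (c := 1 / f sInf))
        (fun u hu => one_div_le_one_div_of_le hfpp (hfge u (hsx hu)))
      simpa using this
    rw [hell' x hx, hLdef, abs_mul, abs_of_pos (one_div_pos.2 hg0), mul_assoc]
    apply mul_le_mul_of_nonneg_left _ (one_div_pos.2 hg0).le
    have h3 : lam * ∫ ρ in x..1, 1 / f ρ ≤ lam * ((1 - x) * (1 / f sInf)) :=
      mul_le_mul_of_nonneg_left hi1 hlam0.le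
    have h4 := mul_nonneg hlam0.le hi0
    have h5 : (1 + lam / f sInf) * (1 - x) = (1 - x) + lam * ((1 - x) * (1 / f sInf)) := by ring
    rw [h5, abs_le]
    constructor <;> linarith
  obtain ⟨D', -, hD'⟩ := hD_smooth
  have hDc : ContinuousOn D (Ico 0 1) := fun x hx => (hD' x hx).continuousWithinAt
  have hDp : ∀ m ∈ Ioo (0:ℝ) 1, 0 < D m := by
    intro m hm
    have hev := hD_zero.eventually (lt_mem_nhds hLD0)
    have hev2 : ∀ᶠ x in 𝓝[>] (0:ℝ), x ∈ Ioo 0 m := Ioo_mem_nhdsGT hm.1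
    obtain ⟨x, hx, hxm⟩ := (hev.and hev2).exists
    have hDx : 0 < D x := by
      have hpow := Real.rpow_pos_of_pos hxm.1 a
      have := mul_pos hx hpow
      rwa [div_mul_cancel₀ _ hpow.ne'] at this
    exact hDx.trans_le (hD_mono ⟨hxm.1.le, hxm.2.trans hm.2⟩ ⟨hm.1.le, hm.2⟩ hxm.2.le)
  have hc : 0 < v ^ 2 / gam := by positivity
  obtain ⟨c1, z1, m1, p1, n1, o1, i1⟩ := h1
  obtain ⟨c2, z2, m2, p2, n2, o2, i2⟩ := h2
  have o1' : ∀ s ∈ Ioo sigma1 1, ∫ ρ in (0:ℝ)..(M1 s), ρ * D ρ =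
      v ^ 2 / gam * ∫ ρ in s..1, (M1 ρ - ell ρ) / f ρ := fun s hs => by
    rw [← hPhi _ ⟨(p1 s hs).1.le, (p1 s hs).2⟩, o1 s hs]
  have o2' : ∀ s ∈ Ioo sigma2 1, ∫ ρ in (0:ℝ)..(M2 s), ρ * D ρ =
      v ^ 2 / gam * ∫ ρ in s..1, (M2 ρ - ell ρ) / f ρ := fun s hs => by
    rw [← hPhi _ ⟨(p2 s hs).1.le, (p2 s hs).2⟩, o2 s hs]
  have hlt1 : sigma1 < 1 := by obtain ⟨s, hs, -⟩ := i1; exact hs.1.trans hs.2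
  have hlt2 : sigma2 < 1 := by obtain ⟨s, hs, -⟩ := i2; exact hs.1.trans hs.2
  have heq : ∀ s, s ∈ Ioo sigma1 1 → s ∈ Ioo sigma2 1 → M1 s = M2 s := fun s hs hs' =>
    le_antisymm
      (no_gt hc hL m1.1 m2.1 hfc hf0 hellc hellL hDc hD_mono hDp c1 z1 p1 o1' i1 c2 z2 p2 o2' i2 s hs hs')
      (no_gt hc hL m2.1 m1.1 hfc hf0 hellc hellL hDc hD_mono hDp c2 z2 p2 o2' i2 c1 z1 p1 o1' i1 s hs' hs)
  have hmaxlt : max sigma1 sigma2 < 1 := max_lt hlt1 hlt2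
  have heqσ : M1 (max sigma1 sigma2) = M2 (max sigma1 sigma2) := by
    have hS : Icc (max sigma1 sigma2) 1 ⊆ Icc sInf 1 := Icc_subset_Icc_left (m1.1.trans (le_max_left _ _))
    have hE : EqOn M1 M2 (Ioo (max sigma1 sigma2) 1) := fun s hs =>
      heq s ⟨(le_max_left _ _).trans_lt hs.1, hs.2⟩ ⟨(le_max_right _ _).trans_lt hs.1, hs.2⟩
    have hE2 := hE.of_subset_closure (c1.mono hS) (c2.mono hS) Ioo_subset_Icc_self
      (by rw [closure_Ioo hmaxlt.ne])
    exact hE2 (left_mem_Icc.2 hmaxlt.le)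
  have hσ : sigma1 = sigma2 := by
    rcases lt_trichotomy sigma1 sigma2 with h | h | h
    · rw [max_eq_right h.le, n2 _ ⟨m2.1, le_rfl⟩] at heqσ
      linarith [(p1 sigma2 ⟨h, hlt2⟩).1]
    · exact h
    · rw [max_eq_left h.le, n1 _ ⟨m1.1, le_rfl⟩] at heqσ
      linarith [(p2 sigma1 ⟨h, hlt1⟩).1]
  subst hσ
  intro s hs
  rcases le_or_gt s sigma1 with h | h
  · rw [n1 s ⟨hs.1, h⟩, n2 s ⟨hs.1, h⟩]
  · rcases hs.2.lt_or_eq with h' | h'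
    · exact heq s ⟨h, h'⟩ ⟨h, h'⟩
    · rw [h', z1, z2]
end

section
/- If 0 < v₁ < v₂, then for every s ∈ [s₋∞,1) one has Φ(𝔐_{v₂}(s)) ≥ (v₂²/v₁²) Φ(𝔐_{v₁}(s)); in particular 𝔐_{v₁}(s) ≤ 𝔐_{v₂}(s), with strict inequality whenever 𝔐_{v₁}(s) > 0. -/
open Set Filter Topology MeasureTheory intervalIntegral in
theorem prim_facts (h : ℝ → ℝ) (hc : ContinuousOn h (Set.Ico (0:ℝ) 1))
    (hp : ∀ x ∈ Set.Ioo (0:ℝ) 1, 0 < h x) :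
    (∀ m ∈ Set.Ioo (0:ℝ) 1, HasStrictDerivAt (fun m => ∫ ρ in (0:ℝ)..m, h ρ) (h m) m) ∧
    ContinuousOn (fun m => ∫ ρ in (0:ℝ)..m, h ρ) (Set.Ico (0:ℝ) 1) ∧
    StrictMonoOn (fun m => ∫ ρ in (0:ℝ)..m, h ρ) (Set.Ico (0:ℝ) 1) := by
  have h1 : ∀ m ∈ Set.Ioo (0:ℝ) 1,
      HasStrictDerivAt (fun m => ∫ ρ in (0:ℝ)..m, h ρ) (h m) m := by
    intro m hm
    apply integral_hasStrictDerivAt_right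
    · apply ContinuousOn.intervalIntegrable
      apply hc.mono
      rw [uIcc_of_le hm.1.le]
      intro x hx
      exact ⟨hx.1, hx.2.trans_lt hm.2⟩
    · exact ContinuousOn.stronglyMeasurableAtFilter isOpen_Ioo
        (hc.mono Ioo_subset_Ico_self) m hm
    · exact hc.continuousAt (Ico_mem_nhds hm.1 hm.2)
  have h2 : ContinuousOn (fun m => ∫ ρ in (0:ℝ)..m, h ρ) (Set.Ico (0:ℝ) 1) := by
    intro x hx
    rcases eq_or_lt_of_le hx.1 with h0 | h0
    · subst h0
      have : ContinuousOn (fun m => ∫ ρ in (0:ℝ)..m, h ρ) (Set.Icc (0:ℝ) (1/2)) := by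
        have := continuousOn_primitive_interval (μ := volume) (f := h) (a := 0) (b := 1/2) (by
          apply ContinuousOn.integrableOn_compact isCompact_uIcc
          apply hc.mono
          rw [uIcc_of_le (by norm_num)]
          intro x hx
          exact ⟨hx.1, hx.2.trans_lt (by norm_num)⟩)
        rwa [uIcc_of_le (by norm_num)] at this
      have := this 0 (by constructor <;> norm_num)
      apply this.mono_of_mem_nhdsWithin
      filter_upwards [self_mem_nhdsWithin, mem_nhdsWithin_of_mem_nhds (Iio_mem_nhds (show (0:ℝ) < 1/2 by norm_num))] with y hy hy2
      exact ⟨hy.1, le_of_lt hy2⟩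
    · exact (h1 x ⟨h0, hx.2⟩).hasDerivAt.continuousAt.continuousWithinAt
  refine ⟨h1, h2, ?_⟩
  apply strictMonoOn_of_deriv_pos (convex_Ico 0 1) h2
  intro x hx
  rw [interior_Ico] at hx
  rw [(h1 x hx).hasDerivAt.deriv]
  exact hp x hx

open Set Filter Topology in
theorem comp_deriv (Ph G M W : ℝ → ℝ) (s p g w : ℝ) (hP : HasStrictDerivAt Ph p (M s))
    (hp : p ≠ 0) (hG : HasDerivAt G g (M s)) (hM : ContinuousAt M s)
    (hW : HasDerivAt W w s) (he : (fun x => Ph (M x)) =ᶠ[𝓝 s] W) :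
    HasDerivAt (fun x => G (M x)) (g * (w / p)) s := by
  have hPM : HasDerivAt (fun x => Ph (M x)) w s := hW.congr_of_eventuallyEq he
  have hL := hP.to_localInverse hp
  have hM' : HasDerivAt M (w / p) s := by
    have h2 := HasDerivAt.comp s hL.hasDerivAt hPM
    have h3 : (p⁻¹ * w) = w / p := by field_simp
    rw [h3] at h2
    apply h2.congr_of_eventuallyEq
    have := (hP.hasStrictFDerivAt_equiv hp).eventually_left_inverse
    filter_upwards [hM.eventually this] with x hx
    exact hx.symm
  exact HasDerivAt.comp s hG hM'

open Set Filter Topology MeasureTheory intervalIntegral in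
/-- derivative of the tail integral -/
theorem tail_deriv (c : ℝ) (g : ℝ → ℝ) (hg : ContinuousOn g (Set.Icc c 1)) :
    (∀ s ∈ Set.Ioo c 1, HasDerivAt (fun s => ∫ ρ in s..1, g ρ) (- g s) s) ∧
    (∀ s ∈ Set.Icc c 1, ∀ t ∈ Set.Icc c 1, IntervalIntegrable g volume s t) := by
  have h2 : ∀ s ∈ Set.Icc c 1, ∀ t ∈ Set.Icc c 1, IntervalIntegrable g volume s t := by
    intro s hs t ht
    exact (hg.mono (uIcc_subset_Icc hs ht)).intervalIntegrable
  refine ⟨?_, h2⟩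
  intro s hs
  apply integral_hasDerivAt_left (h2 s (Ioo_subset_Icc_self hs) 1 ⟨(hs.1.trans hs.2).le, le_rfl⟩)
  · exact ContinuousOn.stronglyMeasurableAtFilter isOpen_Ioo
        (hg.mono Ioo_subset_Icc_self) s hs
  · exact hg.continuousAt (Icc_mem_nhds hs.1 hs.2)

open Set Filter Topology MeasureTheory intervalIntegral in
theorem G_asymp (gam v c sigma C : ℝ) (f ell Phi M D : ℝ → ℝ)
    (hfc : ContinuousOn f (Icc c 1)) (hfp : ∀ x ∈ Icc c 1, 0 < f x)
    (hgam : 0 < gam)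
    (hellc : ContinuousOn ell (Icc c 1)) (hellb : ∀ x ∈ Icc c 1, |ell x| ≤ C * (1 - x))
    (hDc : ContinuousOn D (Ico 0 1)) (hDp : ∀ x ∈ Ioo (0:ℝ) 1, 0 < D x)
    (hPhi : ∀ m ∈ Set.Ico (0:ℝ) 1, Phi m = ∫ ρ in (0:ℝ)..m, ρ * D ρ)
    (hM : IsMMap gam v c sigma f ell Phi M) :
    ∃ s0 ∈ Ioo sigma 1, IntervalIntegrable (fun ρ => 1 / (f ρ * M ρ)) volume s0 1 ∧
      ∀ s ∈ Ico s0 1, |(∫ ρ in (0:ℝ)..(M s), D ρ) - v ^ 2 / gam * ∫ ρ in s..1, 1 / f ρ| ≤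
        v ^ 2 / gam * (C * (1 - s) * ∫ ρ in s..1, 1 / (f ρ * M ρ)) := by
  obtain ⟨hMc, hM1, hsig, hMp, hM0, hMeq, s0, hs0, hint⟩ := hM
  refine ⟨s0, hs0, hint, ?_⟩
  intro s hs
  obtain ⟨hG1, hG2, hG3⟩ := prim_facts D hDc hDp
  obtain ⟨hP1, hP2, hP3⟩ := prim_facts (fun ρ => ρ * D ρ) (continuousOn_id.mul hDc)
    (fun x hx => mul_pos hx.1 (hDp x hx))
  have hcs : ∀ x ∈ Icc s 1, x ∈ Icc c 1 := fun x hx =>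
    ⟨(hsig.1.trans hs0.1.le).trans (hs.1.trans hx.1), hx.2⟩
  have hsg : ∀ x ∈ Ico s 1, x ∈ Ioo sigma 1 := fun x hx =>
    ⟨hs0.1.trans_le (hs.1.trans hx.1), hx.2⟩
  have hMIco : ∀ x ∈ Icc s 1, M x ∈ Ico (0:ℝ) 1 := by
    intro x hx
    rcases eq_or_lt_of_le hx.2 with h | h
    · subst h; rw [hM1]; simp
    · have := hMp x (hsg x ⟨hx.1, h⟩)
      exact ⟨this.1.le, this.2⟩
  have hgc : ContinuousOn (fun ρ => (M ρ - ell ρ) / f ρ) (Icc c 1) :=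
    (hMc.sub hellc).div hfc (fun x hx => (hfp x hx).ne')
  obtain ⟨ht1, ht2⟩ := tail_deriv c _ hgc
  have hder : ∀ x ∈ Ioo s 1, HasDerivAt (fun x => ∫ ρ in (0:ℝ)..(M x), D ρ)
      (- (v ^ 2 / gam) * (1 / f x - ell x * (1 / (f x * M x)))) x := by
    intro x hx
    have hxs := hsg x ⟨hx.1.le, hx.2⟩
    have hmx := hMp x hxs
    have hxc : x ∈ Ioo c 1 := ⟨hsig.1.trans_lt hxs.1, hxs.2⟩
    have hfx := hfp x (Ioo_subset_Icc_self hxc)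
    have hDx := hDp _ hmx
    have := comp_deriv (fun m => ∫ ρ in (0:ℝ)..m, ρ * D ρ) (fun m => ∫ ρ in (0:ℝ)..m, D ρ) M
      (fun s => v ^ 2 / gam * ∫ ρ in s..1, (M ρ - ell ρ) / f ρ) x _ _ _ (hP1 _ hmx)
      (mul_pos hmx.1 hDx).ne' (hG1 _ hmx).hasDerivAt
      (hMc.continuousAt (Icc_mem_nhds hxc.1 hxc.2)) ((ht1 x hxc).const_mul _) (by
        filter_upwards [Ioo_mem_nhds hxs.1 hxs.2] with y hy
        have hmy := hMp y hy
        show ∫ ρ in (0:ℝ)..(M y), ρ * D ρ = _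
        rw [← hPhi _ ⟨hmy.1.le, hmy.2⟩]
        exact hMeq y hy)
    convert this using 1
    have := hmx.1.ne'
    field_simp
  have hs1 : s ≤ 1 := hs.2.le
  have hint' : IntervalIntegrable (fun ρ => 1 / (f ρ * M ρ)) volume s 1 := by
    apply hint.mono_set
    rw [uIcc_of_le hs1, uIcc_of_le hs0.2.le]
    exact Icc_subset_Icc_left hs.1
  have hi1 : IntervalIntegrable (fun ρ => 1 / f ρ) volume s 1 := by
    apply ContinuousOn.intervalIntegrable
    rw [uIcc_of_le hs1]
    exact continuousOn_const.div (hfc.mono hcs) (fun x hx => (hfp x (hcs x hx)).ne')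
  have hi2 : IntervalIntegrable (fun ρ => ell ρ * (1 / (f ρ * M ρ))) volume s 1 := by
    apply hint'.continuousOn_mul
    rw [uIcc_of_le hs1]
    exact hellc.mono hcs
  have hFTC := integral_eq_sub_of_hasDerivAt_of_le hs1 (hG2.comp (hMc.mono hcs) hMIco) hder
    ((hi1.sub hi2).const_mul _)
  rw [intervalIntegral.integral_const_mul, intervalIntegral.integral_sub hi1 hi2] at hFTC
  simp only [Function.comp, hM1, integral_same] at hFTC
  have hb : |∫ ρ in s..1, ell ρ * (1 / (f ρ * M ρ))| ≤
      C * (1 - s) * ∫ ρ in s..1, 1 / (f ρ * M ρ) := by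
    rw [← intervalIntegral.integral_const_mul, ← Real.norm_eq_abs]
    apply norm_integral_le_of_norm_le hs1 _ (hint'.const_mul _)
    apply Eventually.of_forall
    intro t ht
    have htc := hcs t ⟨ht.1.le, ht.2⟩
    have h1 : 0 ≤ 1 / (f t * M t) := by
      have := hfp t htc
      have := (hMIco t ⟨ht.1.le, ht.2⟩).1
      positivity
    have hC : 0 ≤ C := by
      have h3 := hcs s ⟨le_rfl, hs1⟩
      have h2 := (abs_nonneg _).trans (hellb s h3)
      have : 0 < 1 - s := by linarith [hs.2]
      exact nonneg_of_mul_nonneg_left h2 this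
    rw [Real.norm_eq_abs, abs_mul, abs_of_nonneg h1]
    apply mul_le_mul_of_nonneg_right _ h1
    exact (hellb t htc).trans (mul_le_mul_of_nonneg_left (by linarith [ht.1]) hC)
  have hk : 0 ≤ v ^ 2 / gam := by positivity
  have he : (∫ ρ in (0:ℝ)..(M s), D ρ) - v ^ 2 / gam * ∫ ρ in s..1, 1 / f ρ =
      - (v ^ 2 / gam * ∫ ρ in s..1, ell ρ * (1 / (f ρ * M ρ))) := by linarith
  rw [he, abs_neg, abs_mul, abs_of_nonneg hk]
  exact mul_le_mul_of_nonneg_left hb hk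

open Set Filter Topology MeasureTheory intervalIntegral in
theorem tail_tendsto (g : ℝ → ℝ) (s0 : ℝ) (h0 : s0 < 1) (hg : IntervalIntegrable g volume s0 1) :
    Tendsto (fun s => ∫ ρ in s..1, g ρ) (𝓝[<] 1) (𝓝 0) := by
  have h1 := continuousOn_primitive_interval_left (μ := volume) (f := g) (a := s0) (b := 1) (by
    rw [uIcc_of_le h0.le]
    exact (intervalIntegrable_iff_integrableOn_Icc_of_le h0.le).1 hg)
  rw [uIcc_of_le h0.le] at h1
  have h2 := h1 1 ⟨h0.le, le_rfl⟩
  have h3 : Tendsto (fun s => ∫ ρ in s..1, g ρ) (𝓝[Icc s0 1] 1) (𝓝 (∫ ρ in (1:ℝ)..1, g ρ)) := h2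
  rw [integral_same] at h3
  apply h3.mono_left
  apply le_inf inf_le_left
  rw [le_principal_iff]
  filter_upwards [self_mem_nhdsWithin, mem_nhdsWithin_of_mem_nhds (Ioi_mem_nhds h0)] with x hx hx2
  exact ⟨le_of_lt hx2, le_of_lt hx⟩

open Set Filter Topology MeasureTheory intervalIntegral in
theorem near_one (gam v1 v2 c sigma1 sigma2 C : ℝ) (f ell Phi M1 M2 D : ℝ → ℝ)
    (hfc : ContinuousOn f (Icc c 1)) (hfp : ∀ x ∈ Icc c 1, 0 < f x)
    (hf1 : ∀ x ∈ Icc c 1, f x ≤ 1)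
    (hgam : 0 < gam) (hv1 : 0 < v1) (hv : v1 < v2)
    (hellc : ContinuousOn ell (Icc c 1)) (hellb : ∀ x ∈ Icc c 1, |ell x| ≤ C * (1 - x))
    (hDc : ContinuousOn D (Ico 0 1)) (hDp : ∀ x ∈ Ioo (0:ℝ) 1, 0 < D x)
    (hPhi : ∀ m ∈ Set.Ico (0:ℝ) 1, Phi m = ∫ ρ in (0:ℝ)..m, ρ * D ρ)
    (hM1 : IsMMap gam v1 c sigma1 f ell Phi M1)
    (hM2 : IsMMap gam v2 c sigma2 f ell Phi M2) :
    ∀ᶠ s in 𝓝[<] 1, s ∈ Ioo sigma1 1 ∧ s ∈ Ioo sigma2 1 ∧ M1 s < M2 s := by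
  obtain ⟨s1, hs1, hi1, hb1⟩ := G_asymp gam v1 c sigma1 C f ell Phi M1 D hfc hfp hgam hellc hellb
    hDc hDp hPhi hM1
  obtain ⟨s2, hs2, hi2, hb2⟩ := G_asymp gam v2 c sigma2 C f ell Phi M2 D hfc hfp hgam hellc hellb
    hDc hDp hPhi hM2
  obtain ⟨-, -, hG3⟩ := prim_facts D hDc hDp
  have hE : Tendsto (fun s => v1 ^ 2 * (C * ∫ ρ in s..1, 1 / (f ρ * M1 ρ)) +
      v2 ^ 2 * (C * ∫ ρ in s..1, 1 / (f ρ * M2 ρ))) (𝓝[<] 1) (𝓝 0) := by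
    have := (((tail_tendsto _ s1 hs1.2 hi1).const_mul C).const_mul (v1 ^ 2)).add
      (((tail_tendsto _ s2 hs2.2 hi2).const_mul C).const_mul (v2 ^ 2))
    simpa only [mul_zero, add_zero] using this
  have hvv : 0 < v2 ^ 2 - v1 ^ 2 := by nlinarith
  filter_upwards [self_mem_nhdsWithin, mem_nhdsWithin_of_mem_nhds (Ioi_mem_nhds hs1.2),
    mem_nhdsWithin_of_mem_nhds (Ioi_mem_nhds hs2.2), hE.eventually (gt_mem_nhds hvv)]
    with s h1 h2 h3 h4
  have h1' : s < 1 := h1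
  have m1 : s ∈ Ioo sigma1 1 := ⟨hs1.1.trans h2, h1⟩
  have m2 : s ∈ Ioo sigma2 1 := ⟨hs2.1.trans h3, h1⟩
  refine ⟨m1, m2, ?_⟩
  have p1 := hM1.2.2.2.1 s m1
  have p2 := hM2.2.2.2.1 s m2
  have hcs : ∀ x ∈ Icc s 1, x ∈ Icc c 1 := fun x hx =>
    ⟨(hM1.2.2.1.1.trans m1.1.le).trans hx.1, hx.2⟩
  have b1 := (abs_le.1 (hb1 s ⟨le_of_lt h2, h1⟩)).2
  have b2 := (abs_le.1 (hb2 s ⟨le_of_lt h3, h1⟩)).1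
  have hlow : 1 - s ≤ ∫ ρ in s..1, 1 / f ρ := by
    have : ∫ ρ in s..1, (1:ℝ) ≤ ∫ ρ in s..1, 1 / f ρ := by
      apply integral_mono_on h1'.le (by simp)
      · apply ContinuousOn.intervalIntegrable
        rw [uIcc_of_le h1'.le]
        exact continuousOn_const.div (hfc.mono hcs) (fun x hx => (hfp x (hcs x hx)).ne')
      · intro x hx
        rw [le_div_iff₀ (hfp x (hcs x hx))]
        linarith [hf1 x (hcs x hx)]
    simpa using this
  rw [← hG3.lt_iff_lt ⟨p1.1.le, p1.2⟩ ⟨p2.1.le, p2.2⟩]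
  show (∫ ρ in (0:ℝ)..(M1 s), D ρ) < ∫ ρ in (0:ℝ)..(M2 s), D ρ
  generalize (∫ ρ in (0:ℝ)..(M1 s), D ρ) = g1 at *
  generalize (∫ ρ in (0:ℝ)..(M2 s), D ρ) = g2 at *
  generalize (∫ ρ in s..1, 1 / f ρ) = I at *
  generalize (∫ ρ in s..1, 1 / (f ρ * M1 ρ)) = e1 at *
  generalize (∫ ρ in s..1, 1 / (f ρ * M2 ρ)) = e2 at *
  have k1 : g1 ≤ (v1 ^ 2 * I + v1 ^ 2 * (C * e1) * (1 - s)) / gam := by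
    have : (v1 ^ 2 * I + v1 ^ 2 * (C * e1) * (1 - s)) / gam
      = v1 ^ 2 / gam * I + v1 ^ 2 / gam * (C * (1 - s) * e1) := by ring
    linarith
  have k2 : (v2 ^ 2 * I - v2 ^ 2 * (C * e2) * (1 - s)) / gam ≤ g2 := by
    have : (v2 ^ 2 * I - v2 ^ 2 * (C * e2) * (1 - s)) / gam
      = v2 ^ 2 / gam * I - v2 ^ 2 / gam * (C * (1 - s) * e2) := by ring
    linarith
  refine k1.trans_lt (lt_of_lt_of_le ?_ k2)
  apply div_lt_div_of_pos_right _ hgam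
  have q1 := mul_lt_mul_of_pos_right h4 (show 0 < 1 - s by linarith)
  have q2 := mul_le_mul_of_nonneg_left hlow hvv.le
  linarith

open Set Filter Topology MeasureTheory intervalIntegral in
theorem core (gam v1 v2 c sigma1 sigma2 C : ℝ) (f ell Phi M1 M2 D : ℝ → ℝ)
    (hfc : ContinuousOn f (Icc c 1)) (hfp : ∀ x ∈ Icc c 1, 0 < f x)
    (hf1 : ∀ x ∈ Icc c 1, f x ≤ 1)
    (hgam : 0 < gam) (hv1 : 0 < v1) (hv : v1 < v2)
    (hellc : ContinuousOn ell (Icc c 1)) (hellb : ∀ x ∈ Icc c 1, |ell x| ≤ C * (1 - x))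
    (hDc : ContinuousOn D (Ico 0 1)) (hDp : ∀ x ∈ Ioo (0:ℝ) 1, 0 < D x)
    (hPhi : ∀ m ∈ Set.Ico (0:ℝ) 1, Phi m = ∫ ρ in (0:ℝ)..m, ρ * D ρ)
    (hM1 : IsMMap gam v1 c sigma1 f ell Phi M1)
    (hM2 : IsMMap gam v2 c sigma2 f ell Phi M2) :
    ∀ s ∈ Set.Ico c 1,
        v2 ^ 2 / v1 ^ 2 * Phi (M1 s) ≤ Phi (M2 s) ∧
        M1 s ≤ M2 s ∧ (0 < M1 s → M1 s < M2 s) := by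
  have hnear := near_one gam v1 v2 c sigma1 sigma2 C f ell Phi M1 M2 D hfc hfp hf1 hgam hv1 hv
    hellc hellb hDc hDp hPhi hM1 hM2
  obtain ⟨-, hP2, hP3⟩ := prim_facts (fun ρ => ρ * D ρ) (continuousOn_id.mul hDc)
    (fun x hx => mul_pos hx.1 (hDp x hx))
  have hP2 : ContinuousOn Phi (Ico 0 1) := hP2.congr hPhi
  have hP3 : StrictMonoOn Phi (Ico 0 1) := hP3.congr (fun x hx => (hPhi x hx).symm)
  have hP0 : Phi 0 = 0 := by rw [hPhi 0 (by simp)]; simp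
  have hPpos : ∀ m ∈ Ioo (0:ℝ) 1, 0 < Phi m := by
    intro m hm
    rw [← hP0]
    exact hP3 (by simp) ⟨hm.1.le, hm.2⟩ hm.1
  have hv2 : 0 < v2 := hv1.trans hv
  obtain ⟨hMc1, hM11, hsig1, hMp1, hM01, hMeq1, -⟩ := hM1
  obtain ⟨hMc2, hM12, hsig2, hMp2, hM02, hMeq2, -⟩ := hM2
  have hI : ∀ (M : ℝ → ℝ) (σ : ℝ), M 1 = 0 → (∀ s ∈ Set.Ioo σ 1, 0 < M s ∧ M s < 1) →
      (∀ s ∈ Set.Icc c σ, M s = 0) → ∀ x ∈ Icc c 1, M x ∈ Ico (0:ℝ) 1 := by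
    intro M σ h1 h2 h3 x hx
    rcases le_or_gt x σ with h | h
    · rw [h3 x ⟨hx.1, h⟩]; simp
    · rcases eq_or_lt_of_le hx.2 with h' | h'
      · rw [h', h1]; simp
      · exact ⟨(h2 x ⟨h, h'⟩).1.le, (h2 x ⟨h, h'⟩).2⟩
  have hI1 := hI M1 sigma1 hM11 hMp1 hM01
  have hI2 := hI M2 sigma2 hM12 hMp2 hM02
  have hPn : ∀ m ∈ Ico (0:ℝ) 1, 0 ≤ Phi m := by
    intro m hm
    rw [← hP0]
    exact hP3.monotoneOn (by simp) hm hm.1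
  have hv12 : v1 ^ 2 < v2 ^ 2 := by nlinarith
  have hv1s : 0 < v1 ^ 2 := by positivity
  have hv2s : 0 < v2 ^ 2 := by positivity
  have hg1 : ContinuousOn (fun ρ => (M1 ρ - ell ρ) / f ρ) (Icc c 1) :=
    (hMc1.sub hellc).div hfc (fun x hx => (hfp x hx).ne')
  have hg2 : ContinuousOn (fun ρ => (M2 ρ - ell ρ) / f ρ) (Icc c 1) :=
    (hMc2.sub hellc).div hfc (fun x hx => (hfp x hx).ne')
  obtain ⟨ht1, hti1⟩ := tail_deriv c _ hg1
  obtain ⟨ht2, hti2⟩ := tail_deriv c _ hg2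
  -- strict ordering from the Phi ordering
  have hstrict : ∀ s ∈ Ico c 1, 0 < M1 s → v2 ^ 2 * Phi (M1 s) ≤ v1 ^ 2 * Phi (M2 s) →
      M1 s < M2 s := by
    intro s hs h0 h
    have hsI := Ico_subset_Icc_self hs
    rw [← hP3.lt_iff_lt (hI1 s hsI) (hI2 s hsI)]
    have := hPpos (M1 s) ⟨h0, (hI1 s hsI).2⟩
    by_contra hcon
    push Not at hcon
    nlinarith
  have hmain : ∀ s ∈ Ioo sigma1 1, v2 ^ 2 * Phi (M1 s) ≤ v1 ^ 2 * Phi (M2 s) := by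
    intro s0 hs0
    by_contra hcon
    push Not at hcon
    -- a point close to one with reverse inequality
    obtain ⟨δ, hδ, hδn⟩ := (mem_nhdsLT_iff_exists_Ioo_subset).1 hnear
    obtain ⟨s', hs'1, hs'2⟩ := exists_between (max_lt (show δ < 1 from hδ) hs0.2)
    have hs'δ : δ < s' := (le_max_left _ _).trans_lt hs'1
    have hs'0 : s0 < s' := (le_max_right _ _).trans_lt hs'1
    have hc0 : c < s0 := hsig1.1.trans_lt hs0.1
    have hsub : Icc s0 s' ⊆ Icc c 1 := Icc_subset_Icc hc0.le hs'2.le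
    have hrev : v2 ^ 2 * Phi (M1 s') - v1 ^ 2 * Phi (M2 s') < 0 := by
      obtain ⟨a1, a2, a3⟩ := hδn ⟨hs'δ, hs'2⟩
      rw [hMeq1 s' a1, hMeq2 s' a2]
      have e1 : s' ∈ Icc c 1 := ⟨(hc0.trans hs'0).le, hs'2.le⟩
      have e2 : (1:ℝ) ∈ Icc c 1 := ⟨e1.1.trans e1.2, le_rfl⟩
      have hpos : 0 < ∫ ρ in s'..1, ((M2 ρ - ell ρ) / f ρ - (M1 ρ - ell ρ) / f ρ) := by
        apply intervalIntegral_pos_of_pos_on ((hti2 s' e1 1 e2).sub (hti1 s' e1 1 e2)) _ hs'2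
        intro x hx
        have hx' := (hδn ⟨hs'δ.trans hx.1, hx.2⟩).2.2
        have := hfp x ⟨e1.1.trans hx.1.le, hx.2.le⟩
        rw [← sub_div]
        apply div_pos _ this
        linarith
      rw [intervalIntegral.integral_sub (hti2 s' e1 1 e2) (hti1 s' e1 1 e2)] at hpos
      have : 0 < v1 ^ 2 * v2 ^ 2 / gam := by positivity
      have := mul_pos this hpos
      have e : ∀ A B : ℝ, v2 ^ 2 * (v1 ^ 2 / gam * A) - v1 ^ 2 * (v2 ^ 2 / gam * B)
        = - (v1 ^ 2 * v2 ^ 2 / gam * (B - A)) := by intros; ring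
      rw [e]
      linarith
    have hwc : ContinuousOn (fun s => v2 ^ 2 * Phi (M1 s) - v1 ^ 2 * Phi (M2 s)) (Icc s0 s') :=
      (continuousOn_const.mul (hP2.comp (hMc1.mono hsub) (fun x hx => hI1 x (hsub hx)))).sub
      (continuousOn_const.mul (hP2.comp (hMc2.mono hsub) (fun x hx => hI2 x (hsub hx))))
    have hcl : IsCompact (Icc s0 s' ∩ (fun s => v2 ^ 2 * Phi (M1 s) - v1 ^ 2 * Phi (M2 s)) ⁻¹'
        Iic 0) :=
      isCompact_Icc.of_isClosed_subset (hwc.preimage_isClosed_of_isClosed isClosed_Icc isClosed_Iic)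
        inter_subset_left
    obtain ⟨s1, ⟨hs1I, hs1w⟩, hs1l⟩ := hcl.exists_isLeast ⟨s', ⟨hs'0.le, le_rfl⟩, hrev.le⟩
    have hs1w : v2 ^ 2 * Phi (M1 s1) - v1 ^ 2 * Phi (M2 s1) ≤ 0 := hs1w
    have hlt : s0 < s1 := by
      rcases eq_or_lt_of_le hs1I.1 with h | h
      · exfalso; rw [← h] at hs1w; linarith
      · exact h
    have hleft : ∀ x ∈ Ico s0 s1, 0 < v2 ^ 2 * Phi (M1 x) - v1 ^ 2 * Phi (M2 x) := by
      intro x hx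
      by_contra hcc
      push Not at hcc
      have := hs1l ⟨⟨hx.1, hx.2.le.trans hs1I.2⟩, hcc⟩
      linarith [hx.2]
    have hs11 : s1 < 1 := hs1I.2.trans_lt hs'2
    have m1 : s1 ∈ Ioo sigma1 1 := ⟨hs0.1.trans hlt, hs11⟩
    have hc1 : s1 ∈ Ioo c 1 := ⟨hc0.trans hlt, hs11⟩
    have hlt1 := hstrict s1 ⟨hc1.1.le, hs11⟩ (hMp1 s1 m1).1 (by linarith)
    have m2 : s1 ∈ Ioo sigma2 1 := by
      refine ⟨?_, hs11⟩
      by_contra hcc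
      push Not at hcc
      have := hM02 s1 ⟨hc1.1.le, hcc⟩
      have := (hMp1 s1 m1).1
      linarith
    have hfx := hfp s1 (Ioo_subset_Icc_self hc1)
    have hd := (((ht1 s1 hc1).const_mul (v1 ^ 2 / gam)).const_mul (v2 ^ 2)).sub
      (((ht2 s1 hc1).const_mul (v2 ^ 2 / gam)).const_mul (v1 ^ 2))
    have hdpos : 0 < v2 ^ 2 * (v1 ^ 2 / gam * -((M1 s1 - ell s1) / f s1)) -
        v1 ^ 2 * (v2 ^ 2 / gam * -((M2 s1 - ell s1) / f s1)) := by
      have e : v2 ^ 2 * (v1 ^ 2 / gam * -((M1 s1 - ell s1) / f s1)) -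
        v1 ^ 2 * (v2 ^ 2 / gam * -((M2 s1 - ell s1) / f s1)) =
        v1 ^ 2 * v2 ^ 2 / gam * ((M2 s1 - M1 s1) / f s1) := by ring
      rw [e]
      have : 0 < M2 s1 - M1 s1 := by linarith
      positivity
    have hsl := (hd.tendsto_slope.mono_left (nhdsLT_le_nhdsNE s1)).eventually (lt_mem_nhds hdpos)
    have hev : ∀ᶠ x in 𝓝[<] s1, x ∈ Ioo (max s0 (max sigma1 sigma2)) s1 :=
      Ioo_mem_nhdsLT (max_lt hlt (max_lt m1.1 m2.1))
    obtain ⟨x, hx1, hx2⟩ := (hsl.and hev).exists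
    have hxs0 : s0 < x := (le_max_left _ _).trans_lt hx2.1
    have hxσ1 : sigma1 < x := ((le_max_left _ _).trans (le_max_right _ _)).trans_lt hx2.1
    have hxσ2 : sigma2 < x := ((le_max_right _ _).trans (le_max_right _ _)).trans_lt hx2.1
    have hwx := hleft x ⟨hxs0.le, hx2.2⟩
    rw [hMeq1 x ⟨hxσ1, hx2.2.trans hs11⟩, hMeq2 x ⟨hxσ2, hx2.2.trans hs11⟩] at hwx
    rw [hMeq1 s1 m1, hMeq2 s1 m2] at hs1w
    rw [slope_def_field] at hx1
    have hneg := sub_neg.2 hx2.2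
    have := (div_pos_iff.1 hx1).resolve_left (fun h => lt_asymm h.2 hneg)
    have := this.1
    simp only [Pi.sub_apply] at this
    linarith
  intro s hs
  have hsI := Ico_subset_Icc_self hs
  rcases le_or_gt s sigma1 with h | h
  · have h0 := hM01 s ⟨hs.1, h⟩
    rw [h0, hP0]
    exact ⟨by simpa using hPn _ (hI2 s hsI), (hI2 s hsI).1, fun h => absurd h (lt_irrefl _)⟩
  · have hm := hmain s ⟨h, hs.2⟩
    have hp := (hMp1 s ⟨h, hs.2⟩).1
    have hl := hstrict s hs hp hm
    refine ⟨?_, hl.le, fun _ => hl⟩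
    rw [div_mul_eq_mul_div, div_le_iff₀ hv1s]
    linarith

theorem M_maps_ordered_in_v
    (lam gam kap : ℝ)
    (hlam : lam ∈ Set.Ioo (0:ℝ) 1) (hgam : gam ∈ Set.Ioo (0:ℝ) 1)
    (hkap : kap ∈ Set.Ioc (0:ℝ) 1)
    (f f' F : ℝ → ℝ)
    (hf_maps : ∀ x ∈ Set.Icc (0:ℝ) 1, f x ∈ Set.Icc (0:ℝ) 1)
    (hf_mono : StrictMonoOn f (Set.Icc (0:ℝ) 1))
    (hf_deriv : ∀ x ∈ Set.Icc (0:ℝ) 1, HasDerivWithinAt f (f' x) (Set.Icc (0:ℝ) 1) x)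
    (hf'_cont : ContinuousOn f' (Set.Icc (0:ℝ) 1))
    (hf_zero : f 0 = 0) (hf'_zero : f' 0 = 1 / kap)
    (hf_one : f 1 ∈ Set.Ioc lam 1)
    (hF : ∀ s ∈ Set.Ioc (0:ℝ) 1, F s = ∫ ρ in s..1, 1 / f ρ)
    (D : ℝ → ℝ) (a b : ℝ) (ha : 1 < a) (hb : 1 < b)
    (hD_mono : MonotoneOn D (Set.Ico (0:ℝ) 1))
    (hD_nonneg : ∀ m ∈ Set.Ico (0:ℝ) 1, 0 ≤ D m)
    (hD_smooth : ∃ D' : ℝ → ℝ, ContinuousOn D' (Set.Ico (0:ℝ) 1) ∧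
      ∀ m ∈ Set.Ico (0:ℝ) 1, HasDerivWithinAt D (D' m) (Set.Ico (0:ℝ) 1) m)
    (LD0 LD1 : ℝ) (hLD0 : 0 < LD0) (hLD1 : 0 < LD1)
    (hD_zero : Filter.Tendsto (fun m => D m / m ^ a) (nhdsWithin 0 (Set.Ioi 0)) (nhds LD0))
    (hD_one : Filter.Tendsto (fun m => (1 - m) ^ b * D m) (nhdsWithin 1 (Set.Iio 1)) (nhds LD1))
    (ell : ℝ → ℝ)
    (hell : ∀ s ∈ Set.Ioc (0:ℝ) 1, ell s = 1 / gam * ((1 - s) - lam * F s))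
    (sInf : ℝ) (hsInf_mem : sInf ∈ Set.Ioo (0:ℝ) 1)
    (hsInf_eq : sInf + lam * F sInf = 1)
    (hsInf_uniq : ∀ s ∈ Set.Ioo (0:ℝ) 1, s + lam * F s = 1 → s = sInf)
    (sM : ℝ) (hsM_mem : sM ∈ Set.Ioo (0:ℝ) 1) (hsM_eq : f sM = lam)
    (hpar : sM + lam * F sM < 1 - gam)
    (Phi : ℝ → ℝ)
    (hPhi : ∀ m ∈ Set.Ico (0:ℝ) 1, Phi m = ∫ ρ in (0:ℝ)..m, ρ * D ρ)
    :
    ∀ (v1 v2 sigma1 sigma2 : ℝ) (M1 M2 : ℝ → ℝ),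
      0 < v1 → v1 < v2 →
      IsMMap gam v1 sInf sigma1 f ell Phi M1 →
      IsMMap gam v2 sInf sigma2 f ell Phi M2 →
      ∀ s ∈ Set.Ico sInf 1,
        v2 ^ 2 / v1 ^ 2 * Phi (M1 s) ≤ Phi (M2 s) ∧
        M1 s ≤ M2 s ∧ (0 < M1 s → M1 s < M2 s) := by
  intro v1 v2 sigma1 sigma2 M1 M2 hv1 hv hM1 hM2
  have hfc0 : ContinuousOn f (Set.Icc (0:ℝ) 1) := fun x hx => (hf_deriv x hx).continuousWithinAt
  have hsub : Set.Icc sInf 1 ⊆ Set.Icc (0:ℝ) 1 := Set.Icc_subset_Icc_left hsInf_mem.1.le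
  have hfc : ContinuousOn f (Set.Icc sInf 1) := hfc0.mono hsub
  have hfi : 0 < f sInf := by
    rw [← hf_zero]
    exact hf_mono (by simp) ⟨hsInf_mem.1.le, hsInf_mem.2.le⟩ hsInf_mem.1
  have hfge : ∀ x ∈ Set.Icc sInf 1, f sInf ≤ f x := fun x hx =>
    hf_mono.monotoneOn ⟨hsInf_mem.1.le, hsInf_mem.2.le⟩ (hsub hx) hx.1
  have hfp : ∀ x ∈ Set.Icc sInf 1, 0 < f x := fun x hx => hfi.trans_le (hfge x hx)
  have hg0 : 0 < gam := hgam.1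
  have hgc : ContinuousOn (fun ρ => 1 / f ρ) (Set.Icc sInf 1) :=
    continuousOn_const.div hfc (fun x hx => (hfp x hx).ne')
  have hIoc : ∀ x ∈ Set.Icc sInf 1, x ∈ Set.Ioc (0:ℝ) 1 := fun x hx =>
    ⟨hsInf_mem.1.trans_le hx.1, hx.2⟩
  have hFc : ContinuousOn F (Set.Icc sInf 1) := by
    have h1 := intervalIntegral.continuousOn_primitive_interval_left (μ := MeasureTheory.volume)
      (f := fun ρ => 1 / f ρ) (a := sInf) (b := 1) (by
        rw [Set.uIcc_of_le hsInf_mem.2.le]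
        exact hgc.integrableOn_Icc)
    rw [Set.uIcc_of_le hsInf_mem.2.le] at h1
    exact h1.congr (fun x hx => hF x (hIoc x hx))
  have hellc : ContinuousOn ell (Set.Icc sInf 1) := by
    have : ContinuousOn (fun s => 1 / gam * ((1 - s) - lam * F s)) (Set.Icc sInf 1) :=
      continuousOn_const.mul ((continuousOn_const.sub continuousOn_id).sub
        (continuousOn_const.mul hFc))
    exact this.congr (fun x hx => hell x (hIoc x hx))
  have hellb : ∀ x ∈ Set.Icc sInf 1, |ell x| ≤ (1 / gam * (1 + lam / f sInf)) * (1 - x) := by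
    intro x hx
    have hFb : ‖F x‖ ≤ 1 / f sInf * |1 - x| := by
      rw [hF x (hIoc x hx)]
      apply intervalIntegral.norm_integral_le_of_norm_le_const
      intro t ht
      rw [Set.uIoc_of_le hx.2] at ht
      have htI : t ∈ Set.Icc sInf 1 := ⟨hx.1.trans ht.1.le, ht.2⟩
      have hft := hfp t htI
      rw [Real.norm_eq_abs, abs_of_nonneg (by positivity)]
      exact one_div_le_one_div_of_le hfi (hfge t htI)
    have h1x : 0 ≤ 1 - x := by linarith [hx.2]
    rw [Real.norm_eq_abs, abs_of_nonneg h1x] at hFb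
    rw [hell x (hIoc x hx), abs_mul, abs_of_nonneg (by positivity), mul_assoc]
    apply mul_le_mul_of_nonneg_left _ (by positivity)
    calc |1 - x - lam * F x| ≤ |1 - x| + |lam * F x| := abs_sub _ _
      _ = (1 - x) + lam * |F x| := by rw [abs_of_nonneg h1x, abs_mul, abs_of_pos hlam.1]
      _ ≤ (1 - x) + lam * (1 / f sInf * (1 - x)) := by
        have := mul_le_mul_of_nonneg_left hFb hlam.1.le
        linarith
      _ = _ := by ring
  have hDc : ContinuousOn D (Set.Ico 0 1) := by
    obtain ⟨D', -, hD'⟩ := hD_smooth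
    exact fun x hx => (hD' x hx).continuousWithinAt
  have hDp : ∀ x ∈ Set.Ioo (0:ℝ) 1, 0 < D x := by
    intro x hx
    have h1 := hD_zero.eventually (lt_mem_nhds hLD0)
    have h2 : ∀ᶠ y in nhdsWithin (0:ℝ) (Set.Ioi 0), y ∈ Set.Ioo 0 x := Ioo_mem_nhdsGT hx.1
    obtain ⟨y, hy1, hy2⟩ := (h1.and h2).exists
    have hya : 0 < y ^ a := Real.rpow_pos_of_pos hy2.1 a
    have : 0 < D y := (div_pos_iff_of_pos_right hya).1 hy1
    exact this.trans_le (hD_mono ⟨hy2.1.le, hy2.2.trans hx.2⟩ ⟨hx.1.le, hx.2⟩ hy2.2.le)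
  exact core gam v1 v2 sInf sigma1 sigma2 _ f ell Phi M1 M2 D hfc hfp
    (fun x hx => (hf_maps x (hsub hx)).2) hg0 hv1 hv hellc hellb hDc hDp hPhi hM1 hM2
end
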